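/- For every integer n ≥ 2 and every integer k with 1 ≤ k < n, there exists a stable wiring for the uniform (n,k)-BDNF game. -/

import Mathlib

namespace BDNF

variable {V : Type} [DecidableEq V]

/-- `connIn s m v u` : there is a directed path with at most `m` edges from `v`
to `u` in the directed graph defined by the wiring `s`. -/
def connIn (s : V → Finset V) : ℕ → V → V → Prop
  | 0, v, u => v = u
  | m + 1, v, u => v = u ∨ ∃ w ∈ s v, connIn s m w u

/-- Directed hop distance from `v` to `u`, with disconnection penalty `M`. -/
noncomputable def distW (s : V → Finset V) (M : ℕ) (v u : V) : ℕ := by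
  classical exact if h : ∃ m, connIn s m v u then Nat.find h else M

/-- Cost of node `v` in the uniform game: the sum of its distances to all
other nodes. -/
noncomputable def cost [Fintype V] (s : V → Finset V) (M : ℕ) (v : V) : ℕ :=
  ∑ u ∈ Finset.univ.filter (fun u => u ≠ v), distW s M v u

/-- `s` is a wiring with out-degree bound `k`: every node links to at most `k`
other nodes. -/
def IsWiring (k : ℕ) (s : V → Finset V) : Prop :=
  ∀ v, v ∉ s v ∧ (s v).card ≤ k

/-- `s` is stable (a pure Nash equilibrium) for the uniform game: no node can
strictly decrease its cost by rewiring its own out-links. -/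
def Stable [Fintype V] (k M : ℕ) (s : V → Finset V) : Prop :=
  ∀ (v : V) (t : Finset V), v ∉ t → t.card ≤ k →
    cost s M v ≤ cost (Function.update s v t) M v

section

open Finset

set_option linter.unusedSectionVars false

lemma connIn_mono_succ {s : V → Finset V} {m : ℕ} {v u : V} (h : connIn s m v u) :
    connIn s (m + 1) v u := by
  induction m generalizing v with
  | zero => exact Or.inl h
  | succ m ih =>
    rcases h with h | ⟨w, hw, h⟩
    · exact Or.inl h
    · exact Or.inr ⟨w, hw, ih h⟩

lemma connIn_succ_iff {s : V → Finset V} {m : ℕ} {v u : V} :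
    connIn s (m + 1) v u ↔ connIn s m v u ∨ ∃ w, connIn s m v w ∧ u ∈ s w := by
  induction m generalizing v with
  | zero =>
    simp only [connIn]
    constructor
    · rintro (h | ⟨w, hw, rfl⟩)
      · exact Or.inl h
      · exact Or.inr ⟨v, rfl, hw⟩
    · rintro (h | ⟨w, rfl, hw⟩)
      · exact Or.inl h
      · exact Or.inr ⟨u, hw, rfl⟩
  | succ m ih =>
    constructor
    · rintro (h | ⟨w, hw, h⟩)
      · exact Or.inl (Or.inl h)
      · rcases ih.1 h with h | ⟨x, hx, hu⟩
        · exact Or.inl (Or.inr ⟨w, hw, h⟩)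
        · exact Or.inr ⟨x, Or.inr ⟨w, hw, hx⟩, hu⟩
    · rintro (h | ⟨x, hx, hu⟩)
      · exact connIn_mono_succ h
      · rcases hx with rfl | ⟨w, hw, hx⟩
        · exact Or.inr ⟨u, hu, Or.inl rfl⟩
        · exact Or.inr ⟨w, hw, ih.2 (Or.inr ⟨x, hx, hu⟩)⟩

/-- The set of nodes reachable from `v` along at most `i` edges. -/
def ball (s : V → Finset V) : ℕ → V → Finset V
  | 0, v => {v}
  | i + 1, v => ball s i v ∪ (ball s i v).biUnion s

lemma mem_ball_succ {s : V → Finset V} {i : ℕ} {v u : V} :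
    u ∈ ball s (i + 1) v ↔ u ∈ ball s i v ∨ ∃ w ∈ ball s i v, u ∈ s w := by
  simp [ball]

lemma mem_ball {s : V → Finset V} {i : ℕ} {v u : V} : u ∈ ball s i v ↔ connIn s i v u := by
  induction i generalizing u with
  | zero => simp [ball, connIn, eq_comm]
  | succ i ih => simp [mem_ball_succ, connIn_succ_iff, ih]

lemma ball_mono (s : V → Finset V) (v : V) : Monotone fun i => ball s i v :=
  monotone_nat_of_le_succ fun _ => subset_union_left

lemma ball_mem_of_le {s : V → Finset V} {i j : ℕ} {v u : V} (h : u ∈ ball s i v) (hij : i ≤ j) :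
    u ∈ ball s j v := ball_mono s v hij h

lemma self_mem_ball (s : V → Finset V) (i : ℕ) (v : V) : v ∈ ball s i v :=
  ball_mem_of_le (i := 0) (by simp [ball]) (Nat.zero_le i)

lemma ball_step {s : V → Finset V} {i : ℕ} {v w u : V} (hw : w ∈ ball s i v) (hu : u ∈ s w) :
    u ∈ ball s (i + 1) v := mem_ball_succ.2 (Or.inr ⟨w, hw, hu⟩)

lemma ball_succ_eq_insert (s : V → Finset V) (i : ℕ) (v : V) :
    ball s (i + 1) v = insert v ((ball s i v).biUnion s) := by
  induction i with
  | zero => rfl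
  | succ i ih =>
    ext u
    rw [mem_ball_succ, mem_insert, mem_biUnion]
    constructor
    · rintro (h | h)
      · rw [ih, mem_insert, mem_biUnion] at h
        rcases h with h | ⟨w, hw, h⟩
        · exact Or.inl h
        · exact Or.inr ⟨w, ball_mem_of_le hw (Nat.le_succ i), h⟩
      · exact Or.inr h
    · rintro (rfl | h)
      · exact Or.inl (self_mem_ball s _ u)
      · exact Or.inr h

lemma distW_le {s : V → Finset V} {M i : ℕ} {v u : V} (h : u ∈ ball s i v) :
    distW s M v u ≤ i := by
  classical
  rw [mem_ball] at h
  unfold distW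
  rw [dif_pos ⟨i, h⟩]
  exact Nat.find_min' _ h

lemma mem_ball_distW {s : V → Finset V} {M i : ℕ} {v u : V} (h : u ∈ ball s i v) :
    u ∈ ball s (distW s M v u) v := by
  classical
  rw [mem_ball] at h ⊢
  unfold distW
  rw [dif_pos ⟨i, h⟩]
  exact Nat.find_spec (⟨i, h⟩ : ∃ m, connIn s m v u)

lemma distW_eq_of_unreachable {s : V → Finset V} {M : ℕ} {v u : V} (h : ∀ i, u ∉ ball s i v) :
    distW s M v u = M := by
  unfold distW
  rw [dif_neg]
  rintro ⟨i, hi⟩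
  exact h i (mem_ball.2 hi)

lemma lt_distW {s : V → Finset V} {M i : ℕ} {v u : V} (h : u ∉ ball s i v) (hi : i < M) :
    i < distW s M v u := by
  by_cases hr : ∃ j, u ∈ ball s j v
  · obtain ⟨j, hj⟩ := hr
    by_contra hc
    exact h (ball_mem_of_le (mem_ball_distW (M := M) hj) (not_lt.1 hc))
  · rw [distW_eq_of_unreachable fun j hj => hr ⟨j, hj⟩]
    exact hi

lemma distW_self (s : V → Finset V) (M : ℕ) (v : V) : distW s M v v = 0 :=
  Nat.le_zero.1 (distW_le (self_mem_ball s 0 v))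

section Cost

variable [Fintype V]

lemma cost_eq_sum (s : V → Finset V) (M : ℕ) (v : V) : cost s M v = ∑ u, distW s M v u := by
  unfold cost
  refine sum_subset (subset_univ _) fun u _ hu => ?_
  have : u = v := by simpa using hu
  rw [this, distW_self]

lemma sum_compl_eq (s : V → Finset V) (v : V) (D : ℕ) :
    ∑ i ∈ range D, (ball s i v)ᶜ.card = ∑ u, ((range D).filter fun i => u ∉ ball s i v).card := by
  simp_rw [card_eq_sum_ones, sum_filter]
  rw [sum_comm]
  refine sum_congr rfl fun i _ => ?_
  rw [← sum_filter]
  congr 1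
  ext u
  simp

lemma sum_compl_le_cost {s : V → Finset V} {M D : ℕ} {v : V} (hD : D ≤ M) :
    ∑ i ∈ range D, (ball s i v)ᶜ.card ≤ cost s M v := by
  rw [sum_compl_eq, cost_eq_sum]
  refine sum_le_sum fun u _ => ?_
  calc _ ≤ (range (distW s M v u)).card := card_le_card fun i hi => by
        rw [mem_filter, mem_range] at hi
        exact mem_range.2 (lt_distW hi.2 (hi.1.trans_le hD))
    _ = _ := card_range _

lemma cost_le_sum_compl {s : V → Finset V} {M D : ℕ} {v : V} (h : ball s D v = univ) :
    cost s M v ≤ ∑ i ∈ range D, (ball s i v)ᶜ.card := by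
  rw [sum_compl_eq, cost_eq_sum]
  refine sum_le_sum fun u _ => ?_
  have hu : u ∈ ball s D v := h ▸ mem_univ u
  calc _ = (range (distW s M v u)).card := (card_range _).symm
    _ ≤ _ := card_le_card fun i hi => by
        rw [mem_range] at hi
        rw [mem_filter, mem_range]
        exact ⟨hi.trans_le (distW_le hu), fun hc => hi.not_ge (distW_le hc)⟩

lemma ball_eq_of_succ_eq {s : V → Finset V} {i : ℕ} {v : V} (h : ball s (i + 1) v = ball s i v)
    (j : ℕ) : ball s (i + j) v = ball s i v := by
  induction j with
  | zero => rfl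
  | succ j ih =>
    rw [← add_assoc]
    change ball s (i + j) v ∪ (ball s (i + j) v).biUnion s = _
    rw [ih]
    exact h

lemma card_ball_ge {s : V → Finset V} {i j : ℕ} {v u : V} (hu : u ∉ ball s i v)
    (hj : u ∈ ball s j v) : i + 1 ≤ (ball s i v).card := by
  induction i with
  | zero => simp [ball]
  | succ i ih =>
    have h1 := ih fun h => hu (ball_mem_of_le h (Nat.le_succ i))
    have hne : ball s i v ≠ ball s (i + 1) v := by
      intro h
      have h2 := ball_eq_of_succ_eq h.symm j
      exact hu (ball_mem_of_le (h2 ▸ ball_mem_of_le hj (Nat.le_add_left j i)) (Nat.le_succ i))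
    have hsub : ball s i v ⊆ ball s (i + 1) v := ball_mono s v (Nat.le_succ i)
    have := card_lt_card (hsub.ssubset_of_ne hne)
    omega

lemma distW_lt_card {s : V → Finset V} {M j : ℕ} {v u : V} (hj : u ∈ ball s j v) :
    distW s M v u < Fintype.card V := by
  rcases Nat.eq_zero_or_pos (distW s M v u) with h | h
  · rw [h]
    exact Fintype.card_pos_iff.2 ⟨v⟩
  · have hu : u ∉ ball s (distW s M v u - 1) v := fun hc => by
      have := distW_le (M := M) hc
      omega
    have := card_ball_ge hu hj
    have h2 : (ball s (distW s M v u - 1) v) ⊂ univ :=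
      (subset_univ _).ssubset_of_ne fun hc => hu (hc ▸ mem_univ u)
    have := card_lt_card h2
    rw [card_univ] at this
    omega

lemma cost_le_sq {s : V → Finset V} {M : ℕ} {v : V} (h : ∀ u, ∃ i, u ∈ ball s i v) :
    cost s M v ≤ Fintype.card V ^ 2 := by
  rw [cost_eq_sum]
  calc _ ≤ ∑ _u : V, Fintype.card V := sum_le_sum fun u _ => (distW_lt_card (h u).choose_spec).le
    _ = _ := by rw [sum_const, card_univ, smul_eq_mul, sq]

lemma le_cost_of_unreachable {s : V → Finset V} {M : ℕ} {v u : V} (h : ∀ i, u ∉ ball s i v) :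
    M ≤ cost s M v := by
  rw [cost_eq_sum]
  refine (distW_eq_of_unreachable (M := M) h).symm.trans_le ?_
  exact single_le_sum (f := fun u => distW s M v u) (fun _ _ => Nat.zero_le _) (mem_univ u)

/-- Out-links of `v` are played optimally. -/
def StableAt (k M : ℕ) (s : V → Finset V) (v : V) : Prop :=
  ∀ t : Finset V, v ∉ t → t.card ≤ k → cost s M v ≤ cost (Function.update s v t) M v

/-- A link of `v` to a node that no other node links to cannot profitably be dropped. -/
lemma cost_le_of_drop_private {s : V → Finset V} {M : ℕ} {v u : V} {t : Finset V}
    (hM : Fintype.card V ^ 2 < M) (hr : ∀ u, ∃ i, u ∈ ball s i v) (huv : u ≠ v)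
    (hp : ∀ w, u ∈ s w → w = v) (hut : u ∉ t) :
    cost s M v ≤ cost (Function.update s v t) M v := by
  refine ((cost_le_sq hr).trans hM.le).trans (le_cost_of_unreachable (u := u) fun i => ?_)
  induction i with
  | zero => simpa [ball] using huv
  | succ i ih =>
    rw [mem_ball_succ]
    rintro (h | ⟨w, -, h⟩)
    · exact ih h
    · by_cases hw : w = v
      · subst hw
        exact hut (by simpa using h)
      · rw [Function.update_of_ne hw] at h
        exact hw (hp w h)

lemma stableAt_of_private {s : V → Finset V} {k M : ℕ} {v : V} (hM : Fintype.card V ^ 2 < M)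
    (hr : ∀ u, ∃ i, u ∈ ball s i v) (hv : v ∉ s v) (hk : k ≤ (s v).card)
    (hp : ∀ u ∈ s v, ∀ w, u ∈ s w → w = v) : StableAt k M s v := by
  intro t _ ht
  by_cases hsub : s v ⊆ t
  · have : s v = t := eq_of_subset_of_card_le hsub (ht.trans hk)
    rw [← this, Function.update_eq_self]
  · obtain ⟨u, hu, hut⟩ := not_subset.1 hsub
    exact cost_le_of_drop_private hM hr (ne_of_mem_of_not_mem hu hv) (hp u hu) hut

end Cost

/-- The Moore bound `1 + k + ⋯ + k ^ i`. -/
def moore (k : ℕ) : ℕ → ℕ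
  | 0 => 1
  | i + 1 => 1 + k * moore k i

lemma moore_eq_sum (k i : ℕ) : moore k i = ∑ j ∈ range (i + 1), k ^ j := by
  induction i with
  | zero => simp [moore]
  | succ i ih =>
    rw [moore, ih, sum_range_succ' _ (i + 1), mul_sum, add_comm]
    simp [pow_succ']

lemma card_ball_le {s : V → Finset V} {k : ℕ} (hs : ∀ v, (s v).card ≤ k) (i : ℕ) (v : V) :
    (ball s i v).card ≤ moore k i := by
  induction i with
  | zero => simp [ball, moore]
  | succ i ih =>
    rw [ball_succ_eq_insert, moore, add_comm]
    refine (card_insert_le _ _).trans (Nat.add_le_add_right ?_ 1)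
    calc _ ≤ (ball s i v).card * k := card_biUnion_le_card_mul _ _ _ fun w _ => hs w
      _ ≤ _ := by rw [mul_comm]; exact Nat.mul_le_mul_left k ih

lemma card_update_le {s : V → Finset V} {k : ℕ} (hs : ∀ v, (s v).card ≤ k) (v : V) {t : Finset V}
    (ht : t.card ≤ k) (w : V) : (Function.update s v t w).card ≤ k := by
  by_cases h : w = v
  · subst h
    simpa using ht
  · simpa [Function.update_of_ne h] using hs w

section Saturated

variable {s : V → Finset V} {k d : ℕ} {v : V}

lemma sum_card_eq_of_card_ball_eq (hs : ∀ v, (s v).card ≤ k)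
    (h : (ball s (d + 1) v).card = moore k (d + 1)) :
    v ∉ (ball s d v).biUnion s ∧ ((ball s d v).biUnion s).card = k * moore k d := by
  have h1 : ((ball s d v).biUnion s).card ≤ k * moore k d := by
    calc _ ≤ (ball s d v).card * k := card_biUnion_le_card_mul _ _ _ fun w _ => hs w
      _ ≤ _ := by rw [mul_comm]; exact Nat.mul_le_mul_left k (card_ball_le hs d v)
  rw [ball_succ_eq_insert, moore] at h
  by_cases hv : v ∈ (ball s d v).biUnion s
  · rw [insert_eq_of_mem hv] at h
    omega
  · rw [card_insert_of_notMem hv] at h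
    exact ⟨hv, by omega⟩

lemma self_notMem_of_saturated (hs : ∀ v, (s v).card ≤ k)
    (h : (ball s (d + 1) v).card = moore k (d + 1)) {u : V} (hu : u ∈ ball s d v) : v ∉ s u :=
  fun hc => (sum_card_eq_of_card_ball_eq hs h).1 (mem_biUnion.2 ⟨u, hu, hc⟩)

lemma biUnion_card_lt (hs : ∀ v, (s v).card ≤ k) {f : V → Finset V} {u : V}
    (hu : u ∈ ball s d v) (hf : ∀ w, f w ⊆ s w) (hfu : (f u).card < k) :
    ((ball s d v).biUnion f).card < k * moore k d := by
  calc _ ≤ ∑ w ∈ ball s d v, (f w).card := card_biUnion_le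
    _ < ∑ _w ∈ ball s d v, k :=
        sum_lt_sum (fun w _ => (card_le_card (hf w)).trans (hs w)) ⟨u, hu, hfu⟩
    _ = (ball s d v).card * k := by simp
    _ ≤ _ := by rw [mul_comm]; exact Nat.mul_le_mul_left k (card_ball_le hs d v)

lemma card_eq_of_saturated (hs : ∀ v, (s v).card ≤ k)
    (h : (ball s (d + 1) v).card = moore k (d + 1)) {u : V} (hu : u ∈ ball s d v) :
    (s u).card = k := by
  by_contra hne
  have := biUnion_card_lt hs hu (f := s) (fun _ => Subset.rfl) ((hs u).lt_of_ne hne)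
  exact this.ne (sum_card_eq_of_card_ball_eq hs h).2

lemma eq_of_saturated (hs : ∀ v, (s v).card ≤ k)
    (h : (ball s (d + 1) v).card = moore k (d + 1)) {u w x : V} (hu : u ∈ ball s d v)
    (hw : w ∈ ball s d v) (hxu : x ∈ s u) (hxw : x ∈ s w) : u = w := by
  by_contra hne
  have h1 := biUnion_card_lt hs hu (f := Function.update s u ((s u).erase x))
    (fun y => by
      by_cases hy : y = u
      · subst hy
        simpa using erase_subset _ _
      · rw [Function.update_of_ne hy])
    (by
      rw [Function.update_self]
      exact (card_lt_card (erase_ssubset hxu)).trans_le (hs u))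
  refine h1.not_ge ?_
  rw [← (sum_card_eq_of_card_ball_eq hs h).2]
  refine card_le_card fun y hy => ?_
  obtain ⟨z, hz, hyz⟩ := mem_biUnion.1 hy
  rw [mem_biUnion]
  by_cases hyx : y = x
  · exact ⟨w, hw, by rw [Function.update_of_ne (Ne.symm hne), hyx]; exact hxw⟩
  · refine ⟨z, hz, ?_⟩
    by_cases hzu : z = u
    · subst hzu
      simpa [hyx] using hyz
    · rwa [Function.update_of_ne hzu]

end Saturated

section Optimal

variable [Fintype V]

/-- A node whose balls attain the Moore bound until they cover everything plays optimally. -/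
lemma stableAt_of_moore_le {s : V → Finset V} {k M D : ℕ} {v : V} (hs : ∀ v, (s v).card ≤ k)
    (hDM : D ≤ M) (h : ∀ i < D, moore k i ≤ (ball s i v).card) (hD : ball s D v = univ) :
    StableAt k M s v := by
  intro t _ ht
  refine (cost_le_sum_compl hD).trans (le_trans ?_ (sum_compl_le_cost hDM))
  refine sum_le_sum fun i hi => ?_
  rw [card_compl, card_compl]
  exact Nat.sub_le_sub_left
    ((card_ball_le (card_update_le hs v ht) i v).trans (h i (mem_range.1 hi))) _

/-- If the balls of `v` miss the Moore bound by one, and only at radius `d + 1`, then any strictly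
better choice of out-links attains it there and covers everything one step later. -/
lemma saturated_of_cost_lt {s : V → Finset V} {k M d : ℕ} {v : V} (hs : ∀ v, (s v).card ≤ k)
    (hDM : d + 3 ≤ M) (h : ∀ i ≤ d, moore k i ≤ (ball s i v).card)
    (h1 : moore k (d + 1) ≤ (ball s (d + 1) v).card + 1) (hD : ball s (d + 2) v = univ)
    {t : Finset V} (ht : t.card ≤ k) (hlt : cost (Function.update s v t) M v < cost s M v) :
    (ball (Function.update s v t) (d + 1) v).card = moore k (d + 1) ∧
      ball (Function.update s v t) (d + 2) v = univ := by
  set s' := Function.update s v t with hs'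
  have hs'k : ∀ w, (s' w).card ≤ k := card_update_le hs v ht
  have hlo := sum_compl_le_cost (s := s') (v := v) hDM
  have hup := cost_le_sum_compl (M := M) hD
  rw [sum_range_succ, sum_range_succ] at hlo
  rw [sum_range_succ] at hup
  have hsum : ∑ i ∈ range (d + 1), (ball s i v)ᶜ.card ≤ ∑ i ∈ range (d + 1), (ball s' i v)ᶜ.card := by
    refine sum_le_sum fun i hi => ?_
    rw [card_compl, card_compl]
    exact Nat.sub_le_sub_left
      ((card_ball_le hs'k i v).trans (h i (Nat.lt_succ_iff.1 (mem_range.1 hi)))) _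
  have hb := card_ball_le hs'k (d + 1) v
  have e1 := card_compl (ball s (d + 1) v)
  have e2 := card_compl (ball s' (d + 1) v)
  have l1 := card_le_univ (ball s (d + 1) v)
  have l2 := card_le_univ (ball s' (d + 1) v)
  have hz : (ball s' (d + 2) v)ᶜ.card = 0 := by omega
  refine ⟨by omega, ?_⟩
  rwa [card_eq_zero, compl_eq_empty_iff] at hz

end Optimal

/-- A forest with levels `1, …, h + 1`, in which every node at a level below `h` has exactly `k`
children, nodes at level `h` have at most `k`, and there are `k` roots. The finset `sub s` is the
subtree below `s`. -/
structure Forest (V : Type) [DecidableEq V] [Fintype V] (k h : ℕ) where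
  lev : V → ℕ
  par : V → V
  sub : V → Finset V
  lev_pos : ∀ v, 1 ≤ lev v
  lev_le : ∀ v, lev v ≤ h + 1
  lev_par : ∀ v, 2 ≤ lev v → lev (par v) + 1 = lev v
  mem_sub : ∀ s u, u ∈ sub s ↔ u = s ∨ (2 ≤ lev u ∧ par u ∈ sub s)
  card_roots : (univ.filter fun v => lev v = 1).card = k
  card_children : ∀ v, lev v < h → (univ.filter fun u => 2 ≤ lev u ∧ par u = v).card = k
  card_children_le : ∀ v, lev v = h → (univ.filter fun u => 2 ≤ lev u ∧ par u = v).card ≤ k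
  two_le_lev_of_leaf : ∀ v, (univ.filter fun u => 2 ≤ lev u ∧ par u = v) = ∅ → 2 ≤ lev v

namespace Forest

variable [Fintype V] {k h : ℕ} (F : Forest V k h)

/-- The roots of the forest. -/
def roots : Finset V := univ.filter fun v => F.lev v = 1

/-- The children of a node. -/
def ch (v : V) : Finset V := univ.filter fun u => 2 ≤ F.lev u ∧ F.par u = v

lemma mem_roots {v : V} : v ∈ F.roots ↔ F.lev v = 1 := by simp [roots]

lemma mem_ch {u v : V} : u ∈ F.ch v ↔ 2 ≤ F.lev u ∧ F.par u = v := by simp [ch]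

variable {F}

lemma lev_of_mem_ch {u v : V} (hu : u ∈ F.ch v) : F.lev u = F.lev v + 1 := by
  rw [mem_ch] at hu
  rw [← hu.2, F.lev_par u hu.1]

lemma mem_ch_par {u : V} (hu : 2 ≤ F.lev u) : u ∈ F.ch (F.par u) := F.mem_ch.2 ⟨hu, rfl⟩

lemma ch_eq_empty_of_lev {v : V} (hv : F.lev v = h + 1) : F.ch v = ∅ := by
  rw [eq_empty_iff_forall_notMem]
  intro u hu
  have := lev_of_mem_ch hu
  have := F.lev_le u
  omega

lemma card_ch {v : V} (hv : F.lev v < h) : (F.ch v).card = k := F.card_children v hv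

lemma card_ch_le (v : V) : (F.ch v).card ≤ k := by
  rcases lt_trichotomy (F.lev v) h with hv | hv | hv
  · exact (card_ch hv).le
  · exact F.card_children_le v hv
  · rw [ch_eq_empty_of_lev (by have := F.lev_le v; omega)]
    exact Nat.zero_le _

lemma par_induction {P : V → Prop} (root : ∀ v, F.lev v = 1 → P v)
    (step : ∀ v, 2 ≤ F.lev v → P (F.par v) → P v) (v : V) : P v := by
  obtain ⟨n, hn⟩ : ∃ n, F.lev v = n := ⟨_, rfl⟩
  induction n generalizing v with
  | zero =>
    have := F.lev_pos v
    omega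
  | succ n ih =>
    by_cases h1 : F.lev v = 1
    · exact root v h1
    · have h2 : 2 ≤ F.lev v := by
        have := F.lev_pos v
        omega
      have := F.lev_par v h2
      exact step v h2 (ih _ (by omega))

lemma self_mem_sub (v : V) : v ∈ F.sub v := (F.mem_sub v v).2 (Or.inl rfl)

lemma mem_sub_of_par {s u : V} (hu : 2 ≤ F.lev u) (h : F.par u ∈ F.sub s) : u ∈ F.sub s :=
  (F.mem_sub s u).2 (Or.inr ⟨hu, h⟩)

lemma par_mem_sub {s u : V} (h : u ∈ F.sub s) (hne : u ≠ s) : F.par u ∈ F.sub s ∧ 2 ≤ F.lev u := by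
  rcases (F.mem_sub s u).1 h with h | h
  · exact absurd h hne
  · exact h.symm

lemma mem_sub_of_mem_ch {s u w : V} (h : w ∈ F.sub s) (hu : u ∈ F.ch w) : u ∈ F.sub s := by
  rw [mem_ch] at hu
  exact mem_sub_of_par hu.1 (hu.2 ▸ h)

lemma lev_lt_of_mem_sub {s : V} (u : V) (h : u ∈ F.sub s) (hne : u ≠ s) : F.lev s < F.lev u := by
  revert h hne
  refine par_induction (F := F) (P := fun u => u ∈ F.sub s → u ≠ s → F.lev s < F.lev u) ?_ ?_ u
  · intro u h1 h hne
    have := (par_mem_sub h hne).2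
    omega
  · intro u h2 ih h hne
    have h3 := (par_mem_sub h hne).1
    have h4 := F.lev_par u h2
    by_cases he : F.par u = s
    · rw [← he]; omega
    · have := ih h3 he
      omega

lemma lev_le_of_mem_sub {s u : V} (h : u ∈ F.sub s) : F.lev s ≤ F.lev u := by
  by_cases hne : u = s
  · rw [hne]
  · exact (lev_lt_of_mem_sub u h hne).le

lemma eq_of_mem_sub_of_lev {s u : V} (h : u ∈ F.sub s) (hl : F.lev u ≤ F.lev s) : u = s := by
  by_contra hne
  exact (lev_lt_of_mem_sub u h hne).not_ge hl

lemma sub_trans {s x : V} (u : V) (hu : u ∈ F.sub x) (hx : x ∈ F.sub s) : u ∈ F.sub s := by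
  revert hu
  refine par_induction (F := F) (P := fun u => u ∈ F.sub x → u ∈ F.sub s) ?_ ?_ u
  · intro u h1 hu
    rwa [eq_of_mem_sub_of_lev hu (by rw [h1]; exact F.lev_pos x)]
  · intro u h2 ih hu
    by_cases hne : u = x
    · rwa [hne]
    · exact mem_sub_of_par h2 (ih (par_mem_sub hu hne).1)

lemma mem_sub_of_common {s x : V} (u : V) (hs : u ∈ F.sub s) (hx : u ∈ F.sub x)
    (hl : F.lev s ≤ F.lev x) : x ∈ F.sub s := by
  revert hs hx
  refine par_induction (F := F) (P := fun u => u ∈ F.sub s → u ∈ F.sub x → x ∈ F.sub s) ?_ ?_ u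
  · intro u h1 hs hx
    rwa [← eq_of_mem_sub_of_lev hx (by rw [h1]; exact F.lev_pos x)]
  · intro u h2 ih hs hx
    by_cases hne : u = x
    · rwa [← hne]
    · refine ih (par_mem_sub hs fun hc => ?_).1 (par_mem_sub hx hne).1
      have := lev_lt_of_mem_sub u hx hne
      rw [hc] at this
      omega

lemma eq_of_common {s x : V} (u : V) (hs : u ∈ F.sub s) (hx : u ∈ F.sub x)
    (hl : F.lev s = F.lev x) : s = x :=
  (eq_of_mem_sub_of_lev (mem_sub_of_common u hs hx hl.le) hl.ge).symm

lemma exists_root (u : V) : ∃ r ∈ F.roots, u ∈ F.sub r := by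
  refine par_induction (F := F) (P := fun u => ∃ r ∈ F.roots, u ∈ F.sub r) ?_ ?_ u
  · exact fun u h => ⟨u, F.mem_roots.2 h, self_mem_sub u⟩
  · rintro u h2 ⟨r, hr, hu⟩
    exact ⟨r, hr, mem_sub_of_par h2 hu⟩

lemma card_lev_le {i : ℕ} (hi : i ≤ h) :
    (univ.filter fun v => F.lev v ≤ i).card + 1 = moore k i := by
  induction i with
  | zero =>
    have : (univ.filter fun v => F.lev v ≤ 0) = ∅ := by
      rw [eq_empty_iff_forall_notMem]
      intro v hv
      have := (mem_filter.1 hv).2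
      have := F.lev_pos v
      omega
    rw [this]
    rfl
  | succ i ih =>
    have heq : (univ.filter fun v => F.lev v ≤ i + 1) =
        F.roots ∪ (univ.filter fun v => F.lev v ≤ i).biUnion F.ch := by
      ext u
      simp only [mem_filter, mem_univ, true_and, mem_union, mem_roots, mem_biUnion]
      constructor
      · intro hu
        by_cases h1 : F.lev u = 1
        · exact Or.inl h1
        · have h2 : 2 ≤ F.lev u := by
            have := F.lev_pos u
            omega
          have := F.lev_par u h2
          exact Or.inr ⟨F.par u, by omega, mem_ch_par h2⟩
      · rintro (hu | ⟨w, hw, hu⟩)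
        · omega
        · rw [lev_of_mem_ch hu]
          omega
    have hdisj : Disjoint F.roots ((univ.filter fun v => F.lev v ≤ i).biUnion F.ch) := by
      rw [disjoint_left]
      intro u hu hu'
      obtain ⟨w, -, hw⟩ := mem_biUnion.1 hu'
      have := (F.mem_ch.1 hw).1
      have := F.mem_roots.1 hu
      omega
    have hcard : ((univ.filter fun v => F.lev v ≤ i).biUnion F.ch).card =
        (univ.filter fun v => F.lev v ≤ i).card * k := by
      rw [card_biUnion]
      · refine sum_const_nat fun w hw => card_ch ?_
        have := (mem_filter.1 hw).2
        omega
      · intro x _ y _ hxy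
        refine disjoint_left.2 fun u hu hu' => ?_
        exact hxy ((F.mem_ch.1 hu).2.symm.trans (F.mem_ch.1 hu').2)
    have hr : F.roots.card = k := F.card_roots
    rw [heq, card_union_of_disjoint hdisj, hcard, hr, moore, ← ih (by omega)]
    ring

/-- A path down the forest is available in every wiring that contains all forest links. -/
lemma mem_ball_of_sub {s : V → Finset V} (hs : ∀ w, F.ch w ⊆ s w) {i : ℕ} {v x : V} (y : V)
    (hx : x ∈ ball s i v) (hy : y ∈ F.sub x) : y ∈ ball s (i + (F.lev y - F.lev x)) v := by
  revert hy
  refine par_induction (F := F)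
    (P := fun y => y ∈ F.sub x → y ∈ ball s (i + (F.lev y - F.lev x)) v) ?_ ?_ y
  · intro y h1 hy
    rw [eq_of_mem_sub_of_lev hy (by rw [h1]; exact F.lev_pos x)]
    exact ball_mem_of_le hx (Nat.le_add_right _ _)
  · intro y h2 ih hy
    by_cases hne : y = x
    · rw [hne]
      exact ball_mem_of_le hx (Nat.le_add_right _ _)
    · have hp := (par_mem_sub hy hne).1
      have h3 := lev_le_of_mem_sub hp
      have h4 := F.lev_par y h2
      refine ball_mem_of_le (ball_step (ih hp) (hs _ (mem_ch_par h2))) ?_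
      omega

/-- From any node one can walk down to a leaf. -/
lemma exists_leaf_in_sub (v : V) : ∃ x ∈ F.sub v, F.ch x = ∅ := by
  obtain ⟨n, hn⟩ : ∃ n, n = h + 1 - F.lev v := ⟨_, rfl⟩
  induction n generalizing v with
  | zero => exact ⟨v, self_mem_sub v, ch_eq_empty_of_lev (by have := F.lev_le v; omega)⟩
  | succ n ih =>
    rcases (F.ch v).eq_empty_or_nonempty with hv | ⟨u, hu⟩
    · exact ⟨v, self_mem_sub v, hv⟩
    · have := lev_of_mem_ch hu
      obtain ⟨x, hx, hc⟩ := ih u (by omega)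
      exact ⟨x, sub_trans x hx (mem_sub_of_mem_ch (self_mem_sub v) hu), hc⟩

variable (F)

/-- The wiring in which leaves link to all roots and other nodes to their children, completed by
the roots in `Y`. -/
def wiring (Y : V → Finset V) (v : V) : Finset V :=
  if F.ch v = ∅ then F.roots else F.ch v ∪ Y v

/-- `Y` completes the out-links of every node that is not a leaf by roots of other trees, of
maximal total tree size. -/
structure IsFilling (Y : V → Finset V) : Prop where
  subset : ∀ v, Y v ⊆ F.roots
  notMem : ∀ v, ∀ r ∈ Y v, v ∉ F.sub r
  card : ∀ v, F.ch v ≠ ∅ → (Y v).card = k - (F.ch v).card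
  max : ∀ v, F.ch v ≠ ∅ → ∀ Z ⊆ F.roots, (∀ r ∈ Z, v ∉ F.sub r) → Z.card = (Y v).card →
    ∑ r ∈ Z, (F.sub r).card ≤ ∑ r ∈ Y v, (F.sub r).card

lemma exists_isFilling : ∃ Y, F.IsFilling Y := by
  have key : ∀ v, ∃ Y : Finset V, Y ⊆ F.roots ∧ (∀ r ∈ Y, v ∉ F.sub r) ∧
      (F.ch v ≠ ∅ → Y.card = k - (F.ch v).card) ∧
      (F.ch v ≠ ∅ → ∀ Z ⊆ F.roots, (∀ r ∈ Z, v ∉ F.sub r) → Z.card = Y.card →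
        ∑ r ∈ Z, (F.sub r).card ≤ ∑ r ∈ Y, (F.sub r).card) := by
    intro v
    by_cases hv : F.ch v = ∅
    · exact ⟨∅, by simp [hv]⟩
    · obtain ⟨r₀, hr₀, hvr⟩ := F.exists_root v
      have hc : k - (F.ch v).card ≤ (F.roots.erase r₀).card := by
        have h1 : F.roots.card = k := F.card_roots
        have h2 := card_pos.2 (nonempty_iff_ne_empty.2 hv)
        rw [card_erase_of_mem hr₀]
        omega
      obtain ⟨Y, hY, hmax⟩ := exists_max_image (powersetCard (k - (F.ch v).card) (F.roots.erase r₀))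
        (fun Y => ∑ r ∈ Y, (F.sub r).card) (powersetCard_nonempty.2 hc)
      rw [mem_powersetCard] at hY
      refine ⟨Y, hY.1.trans (erase_subset _ _), fun r hr hvr' => ?_, fun _ => hY.2,
        fun _ Z hZ hZv hZc => hmax Z (mem_powersetCard.2 ⟨fun r hr => ?_, hZc.trans hY.2⟩)⟩
      · have hr' := mem_erase.1 (hY.1 hr)
        exact hr'.1 (eq_of_common v hvr' hvr
          ((F.mem_roots.1 hr'.2).trans (F.mem_roots.1 hr₀).symm))
      · exact mem_erase.2 ⟨fun hc => hZv r hr (hc ▸ hvr), hZ hr⟩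
  choose Y h1 h2 h3 h4 using key
  exact ⟨Y, h1, h2, h3, h4⟩

variable {F} {Y : V → Finset V}

lemma wiring_of_leaf {v : V} (hv : F.ch v = ∅) : F.wiring Y v = F.roots := if_pos hv

lemma wiring_of_ne {v : V} (hv : F.ch v ≠ ∅) : F.wiring Y v = F.ch v ∪ Y v := if_neg hv

lemma ch_subset_wiring (v : V) : F.ch v ⊆ F.wiring Y v := by
  by_cases hv : F.ch v = ∅
  · rw [hv]
    exact empty_subset _
  · rw [wiring_of_ne hv]
    exact subset_union_left

lemma mem_ch_or_of_mem_wiring (hY : F.IsFilling Y) {u w : V} (hu : u ∈ F.wiring Y w) :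
    u ∈ F.ch w ∨ F.lev u = 1 := by
  by_cases hv : F.ch w = ∅
  · rw [wiring_of_leaf hv, mem_roots] at hu
    exact Or.inr hu
  · rw [wiring_of_ne hv, mem_union] at hu
    exact hu.imp_right fun h => F.mem_roots.1 (hY.subset w h)

lemma eq_par_of_mem_wiring (hY : F.IsFilling Y) {u w : V} (hu : u ∈ F.wiring Y w)
    (h2 : 2 ≤ F.lev u) : w = F.par u := by
  rcases mem_ch_or_of_mem_wiring hY hu with h | h
  · exact (F.mem_ch.1 h).2.symm
  · omega

lemma disjoint_ch (hY : F.IsFilling Y) (v : V) : Disjoint (F.ch v) (Y v) := by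
  rw [disjoint_left]
  intro u hu hu'
  have := (F.mem_ch.1 hu).1
  have := F.mem_roots.1 (hY.subset v hu')
  omega

lemma card_wiring (hY : F.IsFilling Y) (v : V) : (F.wiring Y v).card = k := by
  by_cases hv : F.ch v = ∅
  · rw [wiring_of_leaf hv]
    exact F.card_roots
  · rw [wiring_of_ne hv, card_union_of_disjoint (disjoint_ch hY v), hY.card v hv]
    have := F.card_ch_le v
    omega

lemma wiring_of_full (hY : F.IsFilling Y) {v : V} (hv : (F.ch v).card = k) :
    F.wiring Y v = F.ch v :=
  (eq_of_subset_of_card_le (ch_subset_wiring v) (by rw [hv, card_wiring hY])).symm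

lemma self_notMem_wiring (hY : F.IsFilling Y) (v : V) : v ∉ F.wiring Y v := by
  intro hc
  by_cases hv : F.ch v = ∅
  · rw [wiring_of_leaf hv, mem_roots] at hc
    have := F.two_le_lev_of_leaf v hv
    omega
  · rw [wiring_of_ne hv, mem_union] at hc
    rcases hc with hc | hc
    · have := lev_of_mem_ch hc
      omega
    · exact hY.notMem v v hc (self_mem_sub v)

lemma mem_ball_of_leaf {v : V} (hv : F.ch v = ∅) {i : ℕ} {u : V} (hu : F.lev u ≤ i) :
    u ∈ ball (F.wiring Y) i v := by
  obtain ⟨r, hr, hur⟩ := F.exists_root u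
  have h1 : r ∈ ball (F.wiring Y) (0 + 1) v :=
    ball_step (self_mem_ball _ 0 v) (by rwa [wiring_of_leaf hv])
  have h2 := mem_ball_of_sub ch_subset_wiring u h1 hur
  rw [F.mem_roots.1 hr] at h2
  have := F.lev_pos u
  exact ball_mem_of_le h2 (by omega)

lemma ball_eq_univ_of_leaf {v : V} (hv : F.ch v = ∅) : ball (F.wiring Y) (h + 1) v = univ :=
  eq_univ_of_forall fun u => mem_ball_of_leaf hv (F.lev_le u)

lemma moore_le_of_leaf {v : V} (hv : F.ch v = ∅) {i : ℕ} (hi : i ≤ h) (hiv : i < F.lev v) :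
    moore k i ≤ (ball (F.wiring Y) i v).card := by
  rw [← F.card_lev_le hi, ← card_insert_of_notMem (a := v) (by simp [hiv])]
  refine card_le_card fun u hu => ?_
  rcases mem_insert.1 hu with rfl | hu
  · exact self_mem_ball _ i u
  · exact mem_ball_of_leaf hv (mem_filter.1 hu).2

lemma exists_mem_ball (v u : V) : ∃ i, u ∈ ball (F.wiring Y) i v := by
  obtain ⟨x, hx, hc⟩ := F.exists_leaf_in_sub v
  obtain ⟨r, hr, hur⟩ := F.exists_root u
  have h1 := ball_step (mem_ball_of_sub ch_subset_wiring x (self_mem_ball (F.wiring Y) 0 v) hx)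
    (u := r) (by rwa [wiring_of_leaf hc])
  exact ⟨_, mem_ball_of_sub ch_subset_wiring u h1 hur⟩

variable {M : ℕ}

lemma stableAt_of_full (hY : F.IsFilling Y) (hM : Fintype.card V ^ 2 < M) {v : V}
    (hv : (F.ch v).card = k) : StableAt k M (F.wiring Y) v := by
  refine stableAt_of_private hM (exists_mem_ball v) (self_notMem_wiring hY v)
    (card_wiring hY v).ge fun u hu w hw => ?_
  rw [wiring_of_full hY hv] at hu
  have h1 := F.mem_ch.1 hu
  rw [eq_par_of_mem_wiring hY hw h1.1, h1.2]

lemma stableAt_of_lev_eq (hY : F.IsFilling Y) (hM : h + 2 ≤ M) {v : V} (hv : F.lev v = h + 1) :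
    StableAt k M (F.wiring Y) v := by
  have hc := ch_eq_empty_of_lev hv
  refine stableAt_of_moore_le (D := h + 1) (fun w => (card_wiring hY w).le) (by omega)
    (fun i hi => moore_le_of_leaf hc (by omega) (by omega)) (ball_eq_univ_of_leaf hc)

end Forest

namespace Forest

variable [Fintype V] {k h : ℕ} {F : Forest V k h} {Y : V → Finset V} {M d : ℕ} {v : V}
  {t : Finset V}

/-- What an improving set `t` of out-links of a leaf `v` at level `h = d + 1` would have to
satisfy. -/
structure IsImproving (F : Forest V k h) (Y : V → Finset V) (d : ℕ) (v : V) (t : Finset V) :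
    Prop where
  filling : F.IsFilling Y
  leaf : F.ch v = ∅
  lev_eq : F.lev v = h
  h_eq : h = d + 1
  notMem : v ∉ t
  card_le : t.card ≤ k
  ne_roots : t ≠ F.roots
  card_ball : (ball (Function.update (F.wiring Y) v t) (d + 1) v).card = moore k (d + 1)
  ball_eq : ball (Function.update (F.wiring Y) v t) (d + 2) v = univ

lemma isImproving_of_cost_lt (hY : F.IsFilling Y) (hM : h + 2 ≤ M) (hv : F.ch v = ∅)
    (hlev : F.lev v = h) (hd : h = d + 1) (hvt : v ∉ t) (ht : t.card ≤ k)
    (hlt : cost (Function.update (F.wiring Y) v t) M v < cost (F.wiring Y) M v) :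
    F.IsImproving Y d v t := by
  have hs : ∀ w, (F.wiring Y w).card ≤ k := fun w => (card_wiring hY w).le
  have h1 : moore k (d + 1) ≤ (ball (F.wiring Y) (d + 1) v).card + 1 := by
    rw [← F.card_lev_le hd.ge]
    exact Nat.add_le_add_right
      (card_le_card fun u hu => mem_ball_of_leaf hv (mem_filter.1 hu).2) 1
  have h2 := saturated_of_cost_lt hs (M := M) (d := d) (by omega)
    (fun i hi => moore_le_of_leaf hv (by omega) (by omega)) h1
    (by subst hd; exact ball_eq_univ_of_leaf hv) ht hlt
  refine ⟨hY, hv, hlev, hd, hvt, ht, fun hc => ?_, h2.1, h2.2⟩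
  rw [hc, ← wiring_of_leaf (Y := Y) hv, Function.update_eq_self] at hlt
  exact lt_irrefl _ hlt

/-- Below every node other than `v` there is a node other than `v`, at level at least `h`, with at
most one child. -/
lemma exists_leaflike_in_sub (hk : 2 ≤ k) {x : V} (hx : x ≠ v) :
    ∃ y ∈ F.sub x, y ≠ v ∧ h ≤ F.lev y ∧ (F.ch y).card ≤ 1 := by
  obtain ⟨n, hn⟩ : ∃ n, n = h + 1 - F.lev x := ⟨_, rfl⟩
  induction n generalizing x with
  | zero =>
    have := F.lev_le x
    refine ⟨x, self_mem_sub x, hx, by omega, ?_⟩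
    rw [ch_eq_empty_of_lev (by omega)]
    exact Nat.zero_le _
  | succ n ih =>
    by_cases hc : (F.ch x).card ≤ 1
    · refine ⟨x, self_mem_sub x, hx, ?_, hc⟩
      by_contra hl
      have := F.card_ch (not_le.1 hl)
      omega
    · obtain ⟨c, hc, hcv⟩ := exists_mem_ne (not_le.1 hc) v
      have := lev_of_mem_ch hc
      obtain ⟨y, hy, h1⟩ := ih hcv (by omega)
      exact ⟨y, sub_trans y hy (mem_sub_of_mem_ch (self_mem_sub x) hc), h1⟩

/-- In a forest with two trees, nodes at level at least `h` with at most one child link to the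
root of the other tree. -/
lemma other_root_mem_wiring (hY : F.IsFilling Y) (hk : k = 2) {y ρ r : V} (hc : (F.ch y).card ≤ 1)
    (hρ : ρ ∈ F.roots) (hr : r ∈ F.roots) (hne : r ≠ ρ) (hy : y ∈ F.sub ρ) :
    r ∈ F.wiring Y y := by
  by_cases h0 : F.ch y = ∅
  · rwa [wiring_of_leaf h0]
  · have h1 : (F.ch y).card = 1 := le_antisymm hc (card_pos.2 (nonempty_iff_ne_empty.2 h0))
    have h2 : (Y y).card = 1 := by
      rw [hY.card y h0, h1, hk]
    obtain ⟨a, ha⟩ := card_eq_one.1 h2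
    have haY : a ∈ Y y := by simp [ha]
    have hρa : a ≠ ρ := fun hc => hY.notMem y a haY (hc ▸ hy)
    have hroots : F.roots.card = 2 := F.card_roots.trans hk
    have : a = r := by
      by_contra har
      have : ({a, r, ρ} : Finset V) ⊆ F.roots := by
        intro x hx
        simp only [mem_insert, mem_singleton] at hx
        rcases hx with rfl | rfl | rfl
        exacts [hY.subset y haY, hr, hρ]
      have := card_le_card this
      rw [card_eq_three.2 ⟨a, r, ρ, har, hρa, hne, rfl⟩] at this
      omega
    rw [wiring_of_ne h0, ← this]
    exact mem_union_right _ haY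

namespace IsImproving

lemma update_of_ne {w : V} (hw : w ≠ v) :
    Function.update (F.wiring Y) v t w = F.wiring Y w := Function.update_of_ne hw _ _

variable (H : F.IsImproving Y d v t)
include H

lemma card_update_le (w : V) : (Function.update (F.wiring Y) v t w).card ≤ k :=
  BDNF.card_update_le (fun w => (card_wiring H.filling w).le) v H.card_le w

lemma eq_of_mem {u w x : V} (hu : u ∈ ball (Function.update (F.wiring Y) v t) d v)
    (hw : w ∈ ball (Function.update (F.wiring Y) v t) d v)
    (hxu : x ∈ Function.update (F.wiring Y) v t u)
    (hxw : x ∈ Function.update (F.wiring Y) v t w) : u = w :=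
  eq_of_saturated H.card_update_le H.card_ball hu hw hxu hxw

lemma eq_of_mem_wiring {u w x : V} (hu : u ∈ ball (Function.update (F.wiring Y) v t) d v)
    (hw : w ∈ ball (Function.update (F.wiring Y) v t) d v) (huv : u ≠ v) (hwv : w ≠ v)
    (hxu : x ∈ F.wiring Y u) (hxw : x ∈ F.wiring Y w) : u = w :=
  H.eq_of_mem hu hw (by rwa [update_of_ne huv]) (by rwa [update_of_ne hwv])

lemma eq_of_mem_self {u x : V} (hu : u ∈ ball (Function.update (F.wiring Y) v t) d v)
    (hxt : x ∈ t) (hxu : x ∈ F.wiring Y u) : u = v := by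
  by_contra huv
  exact huv (H.eq_of_mem hu (self_mem_ball _ d v) (by rwa [update_of_ne huv]) (by simpa using hxt))

lemma notMem_wiring {u : V} (hu : u ∈ ball (Function.update (F.wiring Y) v t) d v) (huv : u ≠ v) :
    v ∉ F.wiring Y u := by
  have := self_notMem_of_saturated H.card_update_le H.card_ball hu
  rwa [update_of_ne huv] at this

lemma card_eq : t.card = k := by
  have := card_eq_of_saturated H.card_update_le H.card_ball (self_mem_ball _ d v)
  rwa [Function.update_self] at this

lemma ch_subset (w : V) : F.ch w ⊆ Function.update (F.wiring Y) v t w := by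
  by_cases hw : w = v
  · rw [hw, H.leaf]
    exact empty_subset _
  · rw [update_of_ne hw]
    exact ch_subset_wiring w

lemma mem_ball_one {x : V} (hx : x ∈ t) : x ∈ ball (Function.update (F.wiring Y) v t) 1 v :=
  ball_step (i := 0) (self_mem_ball _ 0 v) (by simpa using hx)

lemma ne_of_mem {x : V} (hx : x ∈ t) : x ≠ v := ne_of_mem_of_not_mem hx H.notMem

lemma par_ne {x : V} (hx : 2 ≤ F.lev x) : F.par x ≠ v := by
  intro hc
  have := mem_ch_par hx
  rw [hc, H.leaf] at this
  exact notMem_empty _ this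

lemma mem_ball_of_mem_sub {i j : ℕ} {x y : V}
    (hx : x ∈ ball (Function.update (F.wiring Y) v t) i v) (hy : y ∈ F.sub x)
    (hj : i + (F.lev y - F.lev x) ≤ j) : y ∈ ball (Function.update (F.wiring Y) v t) j v :=
  ball_mem_of_le (mem_ball_of_sub H.ch_subset y hx hy) hj

lemma eq_of_mem_sub {x y : V} (hx : x ∈ t) (hy : y ∈ t) (hyx : y ∈ F.sub x)
    (hl : F.lev y ≤ F.lev x + d) : x = y := by
  by_contra hne
  obtain ⟨h1, h2⟩ := par_mem_sub hyx (Ne.symm hne)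
  have h3 := F.lev_par y h2
  have h4 := lev_le_of_mem_sub h1
  exact H.par_ne h2 (H.eq_of_mem_self (H.mem_ball_of_mem_sub (H.mem_ball_one hx) h1 (by omega)) hy
    (ch_subset_wiring _ (mem_ch_par h2)))

lemma exists_mem_notMem_roots : ∃ x ∈ t, 2 ≤ F.lev x := by
  by_contra hc
  push Not at hc
  refine H.ne_roots (eq_of_subset_of_card_le (fun x hx => F.mem_roots.2 ?_) ?_)
  · have := hc x hx
    have := F.lev_pos x
    omega
  · rw [H.card_eq]
    exact F.card_roots.le

lemma false_of_card_inter (hk : 3 ≤ k) {y z : V} (hne : y ≠ z)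
    (hy : y ∈ ball (Function.update (F.wiring Y) v t) d v)
    (hz : z ∈ ball (Function.update (F.wiring Y) v t) d v)
    (hyc : k ≤ (Function.update (F.wiring Y) v t y ∩ F.roots).card + 1)
    (hzc : k ≤ (Function.update (F.wiring Y) v t z ∩ F.roots).card + 1) : False := by
  have hdisj : Disjoint (Function.update (F.wiring Y) v t y ∩ F.roots)
      (Function.update (F.wiring Y) v t z ∩ F.roots) := by
    rw [disjoint_left]
    intro x hx hx'
    exact hne (H.eq_of_mem hy hz (mem_inter.1 hx).1 (mem_inter.1 hx').1)
  have h1 := card_le_card (union_subset (inter_subset_right (s₁ := Function.update (F.wiring Y) v t y)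
    (s₂ := F.roots)) (inter_subset_right (s₁ := Function.update (F.wiring Y) v t z)))
  rw [card_union_of_disjoint hdisj, show F.roots.card = k from F.card_roots] at h1
  omega

lemma card_inter_of_leaflike {w : V} (hw : w ≠ v) (hc : (F.ch w).card ≤ 1) :
    k ≤ (Function.update (F.wiring Y) v t w ∩ F.roots).card + 1 := by
  rw [update_of_ne hw]
  by_cases h0 : F.ch w = ∅
  · rw [wiring_of_leaf h0, inter_self, show F.roots.card = k from F.card_roots]
    omega
  · have h1 : Y w ⊆ F.wiring Y w ∩ F.roots := by
      rw [wiring_of_ne h0]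
      exact subset_inter subset_union_right (H.filling.subset w)
    have h2 := card_le_card h1
    rw [H.filling.card w h0] at h2
    omega

lemma exists_leaflike_in_ball (hk : 2 ≤ k) (hd : 1 ≤ d) {x : V} (hx : x ∈ t) (h2 : 2 ≤ F.lev x)
    (hsmall : ∀ u, F.lev u = h → (F.ch u).card ≤ 1) :
    ∃ y ∈ F.sub x, y ≠ v ∧ (F.ch y).card ≤ 1 ∧
      y ∈ ball (Function.update (F.wiring Y) v t) d v := by
  have hh := H.h_eq
  by_cases hl : F.lev x = h + 1
  · refine ⟨x, self_mem_sub x, H.ne_of_mem hx, ?_, ball_mem_of_le (H.mem_ball_one hx) hd⟩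
    rw [ch_eq_empty_of_lev hl]
    exact Nat.zero_le _
  · have key : ∀ n, ∀ x, x ≠ v → F.lev x + n = h → ∃ y ∈ F.sub x, y ≠ v ∧ F.lev y = h := by
      intro n
      induction n with
      | zero => exact fun x hx hn => ⟨x, self_mem_sub x, hx, hn⟩
      | succ n ih =>
        intro x hx hn
        obtain ⟨c, hc, hcv⟩ := exists_mem_ne
          (show 1 < (F.ch x).card by rw [card_ch (by omega)]; omega) v
        have := lev_of_mem_ch hc
        obtain ⟨y, hy, h1⟩ := ih c hcv (by omega)
        exact ⟨y, sub_trans y hy (mem_sub_of_mem_ch (self_mem_sub x) hc), h1⟩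
    have hle := F.lev_le x
    obtain ⟨y, hy, hyv, hyl⟩ := key (h - F.lev x) x (H.ne_of_mem hx) (by omega)
    exact ⟨y, hy, hyv, hsmall y hyl, H.mem_ball_of_mem_sub (H.mem_ball_one hx) hy (by omega)⟩

lemma false_of_three_le (hk : 3 ≤ k) (hd : 1 ≤ d)
    (hsmall : ∀ u, F.lev u = h → (F.ch u).card ≤ 1) : False := by
  have hh := H.h_eq
  obtain ⟨x, hx, hx2⟩ := H.exists_mem_notMem_roots
  obtain ⟨y, hy, hyv, hyc, hyb⟩ := H.exists_leaflike_in_ball (by omega) hd hx hx2 hsmall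
  by_cases hex : ∃ x' ∈ t, x' ≠ x ∧ 2 ≤ F.lev x'
  · obtain ⟨x', hx', hne, hx'2⟩ := hex
    obtain ⟨y', hy', hyv', hyc', hyb'⟩ := H.exists_leaflike_in_ball (by omega) hd hx' hx'2 hsmall
    refine H.false_of_card_inter hk ?_ hyb hyb' (H.card_inter_of_leaflike hyv hyc)
      (H.card_inter_of_leaflike hyv' hyc')
    rintro rfl
    have l1 := F.lev_le x
    have l2 := F.lev_le x'
    rcases le_total (F.lev x) (F.lev x') with hl | hl
    · exact hne (H.eq_of_mem_sub hx hx' (mem_sub_of_common y hy hy' hl) (by omega)).symm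
    · exact hne (H.eq_of_mem_sub hx' hx (mem_sub_of_common y hy' hy hl) (by omega))
  · push Not at hex
    refine H.false_of_card_inter hk hyv hyb (self_mem_ball _ d v)
      (H.card_inter_of_leaflike hyv hyc) ?_
    have h1 : t.erase x ⊆ Function.update (F.wiring Y) v t v ∩ F.roots := by
      intro z hz
      obtain ⟨hzx, hzt⟩ := mem_erase.1 hz
      have := hex z hzt hzx
      have := F.lev_pos z
      rw [Function.update_self]
      exact mem_inter.2 ⟨hzt, F.mem_roots.2 (by omega)⟩
    have h2 := card_le_card h1
    rw [card_erase_of_mem hx, H.card_eq] at h2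
    omega

lemma wiring_eq_ch_of_not_leaflike {w : V} (hk : k = 2) (hw : ¬ (h ≤ F.lev w ∧ (F.ch w).card ≤ 1)) :
    F.wiring Y w = F.ch w := by
  refine wiring_of_full H.filling ?_
  by_cases hl : F.lev w < h
  · exact card_ch hl
  · have := F.card_ch_le w
    have : ¬ (F.ch w).card ≤ 1 := fun hc => hw ⟨not_lt.1 hl, hc⟩
    omega

lemma exists_other_root (hk : k = 2) (ρ : V) : ∃ r ∈ F.roots, r ≠ ρ :=
  exists_mem_ne (by rw [show F.roots.card = k from F.card_roots]; omega) ρ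

lemma false_of_leaflike_pair (hk : k = 2) {y z x : V} (hne : y ≠ z)
    (hy : y ∈ ball (Function.update (F.wiring Y) v t) d v)
    (hz : z ∈ ball (Function.update (F.wiring Y) v t) d v) (hyv : y ≠ v) (hzv : z ≠ v)
    (hyc : (F.ch y).card ≤ 1) (hzc : (F.ch z).card ≤ 1) (hyx : y ∈ F.sub x) (hzx : z ∈ F.sub x) :
    False := by
  obtain ⟨ρ, hρ, hxρ⟩ := F.exists_root x
  obtain ⟨r, hr, hrρ⟩ := H.exists_other_root hk ρ
  exact hne (H.eq_of_mem_wiring hy hz hyv hzv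
    (other_root_mem_wiring H.filling hk hyc hρ hr hrρ (sub_trans y hyx hxρ))
    (other_root_mem_wiring H.filling hk hzc hρ hr hrρ (sub_trans z hzx hxρ)))

lemma false_of_leaf_pair (hk : k = 2) {y z : V} (hne : y ≠ z)
    (hy : y ∈ ball (Function.update (F.wiring Y) v t) d v)
    (hz : z ∈ ball (Function.update (F.wiring Y) v t) d v) (hyv : y ≠ v) (hzv : z ≠ v)
    (hyc : F.ch y = ∅) (hzc : (F.ch z).card ≤ 1) : False := by
  obtain ⟨ρ, hρ, hxρ⟩ := F.exists_root z
  obtain ⟨r, hr, hrρ⟩ := H.exists_other_root hk ρ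
  exact hne (H.eq_of_mem_wiring hy hz hyv hzv (by rwa [wiring_of_leaf hyc])
    (other_root_mem_wiring H.filling hk hzc hρ hr hrρ hxρ))

lemma eq_or_eq_of_mem (hk : k = 2) {x y z : V} (hx : x ∈ t) (hy : y ∈ t) (hne : x ≠ y)
    (hz : z ∈ t) : z = x ∨ z = y := by
  by_contra! hc
  have hsub : ({z, x, y} : Finset V) ⊆ t := by
    intro w hw
    simp only [mem_insert, mem_singleton] at hw
    rcases hw with rfl | rfl | rfl <;> assumption
  have := card_le_card hsub
  rw [card_eq_three.2 ⟨z, x, y, hc.1, hc.2, hne, rfl⟩, H.card_eq] at this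
  omega

lemma false_of_root_mem (hk : k = 2) (hd : 2 ≤ d) {r x : V} (hr : r ∈ t) (hr1 : F.lev r = 1)
    (hx : x ∈ t) (hx2 : 2 ≤ F.lev x) : False := by
  have hh := H.h_eq
  have hv := H.lev_eq
  have hrx : r ≠ x := by
    rintro rfl
    omega
  have hxl : F.lev x ≤ h := by
    by_contra hc
    have hx0 : F.ch x = ∅ := ch_eq_empty_of_lev (by have := F.lev_le x; omega)
    exact H.ne_of_mem hx (H.eq_of_mem_self (ball_mem_of_le (H.mem_ball_one hx) (by omega)) hr
      (by rwa [wiring_of_leaf hx0, mem_roots]))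
  obtain ⟨ρ, hρ, hxρ⟩ := F.exists_root x
  have hρ1 := F.mem_roots.1 hρ
  have hρr : r ≠ ρ := by
    rintro rfl
    exact hrx (H.eq_of_mem_sub hr hx hxρ (by omega))
  have hno : ∀ w ∈ F.sub x, w ∈ ball (Function.update (F.wiring Y) v t) d v → w ≠ v →
      ¬ (h ≤ F.lev w ∧ (F.ch w).card ≤ 1) := fun w hw hwb hwv hc =>
    hwv (H.eq_of_mem_self hwb hr (other_root_mem_wiring H.filling hk hc.2 hρ (F.mem_roots.2 hr1)
      hρr (sub_trans w hw hxρ)))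
  have hinv : ∀ i ≤ h, ∀ u ∈ ball (Function.update (F.wiring Y) v t) i v,
      u = v ∨ (u ∈ F.sub r ∧ F.lev u ≤ i) ∨ u ∈ F.sub x := by
    intro i
    induction i with
    | zero =>
      intro _ u hu
      exact Or.inl (by simpa [ball] using hu)
    | succ i ih =>
      intro hi u hu
      rcases mem_ball_succ.1 hu with hu | ⟨w, hw, hu⟩
      · rcases ih (by omega) u hu with h1 | h1 | h1
        · exact Or.inl h1
        · exact Or.inr (Or.inl ⟨h1.1, by omega⟩)
        · exact Or.inr (Or.inr h1)
      · by_cases hwv : w = v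
        · rw [hwv, Function.update_self] at hu
          rcases H.eq_or_eq_of_mem hk hr hx hrx hu with rfl | rfl
          · exact Or.inr (Or.inl ⟨self_mem_sub u, by omega⟩)
          · exact Or.inr (Or.inr (self_mem_sub u))
        · rw [update_of_ne hwv] at hu
          rcases ih (by omega) w hw with h1 | h1 | h1
          · exact absurd h1 hwv
          · rw [H.wiring_eq_ch_of_not_leaflike hk (by omega)] at hu
            have := lev_of_mem_ch hu
            exact Or.inr (Or.inl ⟨mem_sub_of_mem_ch h1.1 hu, by omega⟩)
          · rw [H.wiring_eq_ch_of_not_leaflike hk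
              (hno w h1 (ball_mem_of_le hw (by omega)) hwv)] at hu
            exact Or.inr (Or.inr (mem_sub_of_mem_ch h1 hu))
  obtain ⟨c, hc, hcx⟩ := exists_mem_ne
    (show 1 < (F.ch ρ).card by rw [card_ch (by omega)]; omega) x
  have hcl := lev_of_mem_ch hc
  have hcρ := mem_sub_of_mem_ch (self_mem_sub ρ) hc
  have hcb : c ∈ ball (Function.update (F.wiring Y) v t) (d + 1 + 1) v := H.ball_eq ▸ mem_univ c
  rcases mem_ball_succ.1 hcb with hcb | ⟨w, hw, hcw⟩
  · rcases hinv (d + 1) hh.ge c hcb with rfl | h1 | h1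
    · omega
    · exact hρr (eq_of_common c h1.1 hcρ (by omega))
    · exact hcx (eq_of_mem_sub_of_lev h1 (by omega))
  · by_cases hwv : w = v
    · rw [hwv, Function.update_self] at hcw
      rcases H.eq_or_eq_of_mem hk hr hx hrx hcw with rfl | rfl
      · omega
      · exact hcx rfl
    · rw [update_of_ne hwv] at hcw
      have hwρ : w = ρ := (eq_par_of_mem_wiring H.filling hcw (by omega)).trans (F.mem_ch.1 hc).2
      rw [hwρ] at hw
      rcases hinv (d + 1) hh.ge ρ hw with rfl | h1 | h1
      · omega
      · exact hρr (eq_of_mem_sub_of_lev h1.1 (by omega)).symm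
      · have := lev_le_of_mem_sub h1
        omega

lemma false_of_leaf_mem (hk : k = 2) (hd : 2 ≤ d) (ht : ∀ x ∈ t, 2 ≤ F.lev x) {x : V}
    (hx : x ∈ t) (hx0 : F.ch x = ∅) : False := by
  have hh := H.h_eq
  have hxb : x ∈ ball (Function.update (F.wiring Y) v t) d v :=
    ball_mem_of_le (H.mem_ball_one hx) (by omega)
  have hxv := H.ne_of_mem hx
  obtain ⟨y, hy, hyx⟩ := exists_mem_ne (show 1 < t.card by rw [H.card_eq]; omega) x
  have hyb := H.mem_ball_one hy
  have hyv := H.ne_of_mem hy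
  by_cases hyl : h ≤ F.lev y
  · by_cases hyc : (F.ch y).card ≤ 1
    · exact H.false_of_leaf_pair hk (Ne.symm hyx) hxb (ball_mem_of_le hyb (by omega)) hxv hyv hx0 hyc
    · obtain ⟨z, hz⟩ := card_pos.1 (show 0 < (F.ch y).card by omega)
      have hzl := lev_of_mem_ch hz
      have hzl' := F.lev_le z
      have hzy : z ∈ F.sub y := mem_sub_of_mem_ch (self_mem_sub y) hz
      refine H.false_of_leaf_pair hk (y := x) (z := z) ?_ hxb
        (H.mem_ball_of_mem_sub hyb hzy (by omega)) hxv ?_ hx0 ?_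
      · rintro rfl
        exact hyx (H.eq_of_mem_sub hy hx hzy (by omega))
      · rintro rfl
        have := H.lev_eq
        omega
      · rw [ch_eq_empty_of_lev (by omega)]
        exact Nat.zero_le _
  · have hy2 := ht y hy
    obtain ⟨ρ, hρ, hyρ⟩ := F.exists_root y
    have hρ1 := F.mem_roots.1 hρ
    have hρb : ρ ∈ ball (Function.update (F.wiring Y) v t) (1 + 1) v :=
      ball_step (H.mem_ball_one hx) (by rwa [update_of_ne hxv, wiring_of_leaf hx0])
    have hyne : y ≠ ρ := by
      rintro rfl
      omega
    have hlp := F.lev_par y hy2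
    exact H.par_ne hy2 (H.eq_of_mem_self
      (H.mem_ball_of_mem_sub hρb (par_mem_sub hyρ hyne).1 (by omega)) hy
      (ch_subset_wiring _ (mem_ch_par hy2)))

lemma false_of_three_le_lev (hk : k = 2) (hd : 2 ≤ d) {x : V} (hx : x ∈ t) (hx3 : 3 ≤ F.lev x)
    (hx0 : F.ch x ≠ ∅) : False := by
  have hh := H.h_eq
  have hxb := H.mem_ball_one hx
  have hxb' : x ∈ ball (Function.update (F.wiring Y) v t) d v := ball_mem_of_le hxb (by omega)
  have hxv := H.ne_of_mem hx
  have hcv : ∀ c ∈ F.ch x, c ≠ v := fun c hc hcv =>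
    H.notMem_wiring hxb' hxv (hcv ▸ ch_subset_wiring x hc)
  have hsub : ∀ c ∈ F.ch x, c ∈ F.sub x := fun c hc => mem_sub_of_mem_ch (self_mem_sub x) hc
  have hball : ∀ y ∈ F.sub x, y ∈ ball (Function.update (F.wiring Y) v t) d v := fun y hy =>
    H.mem_ball_of_mem_sub hxb hy (by have := F.lev_le y; omega)
  by_cases hc1 : (F.ch x).card ≤ 1
  · obtain ⟨z, hz⟩ := nonempty_iff_ne_empty.2 hx0
    have hzl := lev_of_mem_ch hz
    have hxh : h ≤ F.lev x := by
      by_contra hlt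
      have := F.card_ch (not_le.1 hlt)
      omega
    have hz0 : F.ch z = ∅ := ch_eq_empty_of_lev (by have := F.lev_le z; omega)
    refine H.false_of_leaf_pair hk (y := z) (z := x) ?_ (hball z (hsub z hz)) hxb' (hcv z hz) hxv
      hz0 hc1
    rintro rfl
    omega
  · obtain ⟨c, hc, c', hc', hne⟩ := one_lt_card.1 (not_le.1 hc1)
    obtain ⟨y, hy, hyv, -, hyc⟩ := exists_leaflike_in_sub (F := F) (by omega) (hcv c hc)
    obtain ⟨y', hy', hyv', -, hyc'⟩ := exists_leaflike_in_sub (F := F) (by omega) (hcv c' hc')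
    have hyx := sub_trans y hy (hsub c hc)
    have hyx' := sub_trans y' hy' (hsub c' hc')
    refine H.false_of_leaflike_pair hk ?_ (hball y hyx) (hball y' hyx') hyv hyv' hyc hyc' hyx hyx'
    rintro rfl
    exact hne (eq_of_common y hy hy' (by rw [lev_of_mem_ch hc, lev_of_mem_ch hc']))

lemma false_of_lev_eq_two (hk : k = 2) (hd : 2 ≤ d) (ht : ∀ x ∈ t, F.lev x = 2) : False := by
  have hh := H.h_eq
  have hv := H.lev_eq
  have hinv : ∀ i ≤ d, ∀ u ∈ ball (Function.update (F.wiring Y) v t) i v,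
      u = v ∨ ∃ x ∈ t, u ∈ F.sub x ∧ F.lev u ≤ i + 1 := by
    intro i
    induction i with
    | zero =>
      intro _ u hu
      exact Or.inl (by simpa [ball] using hu)
    | succ i ih =>
      intro hi u hu
      rcases mem_ball_succ.1 hu with hu | ⟨w, hw, hu⟩
      · rcases ih (by omega) u hu with h1 | ⟨x, hx, h1, h2⟩
        · exact Or.inl h1
        · exact Or.inr ⟨x, hx, h1, by omega⟩
      · by_cases hwv : w = v
        · rw [hwv, Function.update_self] at hu
          exact Or.inr ⟨u, hu, self_mem_sub u, by rw [ht u hu]; omega⟩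
        · rw [update_of_ne hwv] at hu
          rcases ih (by omega) w hw with h1 | ⟨x, hx, h1, h2⟩
          · exact absurd h1 hwv
          · rw [H.wiring_eq_ch_of_not_leaflike hk (by omega)] at hu
            exact Or.inr ⟨x, hx, mem_sub_of_mem_ch h1 hu, by rw [lev_of_mem_ch hu]; omega⟩
  have hinv' : ∀ u ∈ ball (Function.update (F.wiring Y) v t) (d + 1) v,
      u = v ∨ F.lev u = 1 ∨ ∃ x ∈ t, u ∈ F.sub x := by
    intro u hu
    rcases mem_ball_succ.1 hu with hu | ⟨w, hw, hu⟩
    · rcases hinv d le_rfl u hu with h1 | ⟨x, hx, h1, -⟩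
      · exact Or.inl h1
      · exact Or.inr (Or.inr ⟨x, hx, h1⟩)
    · by_cases hwv : w = v
      · rw [hwv, Function.update_self] at hu
        exact Or.inr (Or.inr ⟨u, hu, self_mem_sub u⟩)
      · rw [update_of_ne hwv] at hu
        rcases hinv d le_rfl w hw with h1 | ⟨x, hx, h1, -⟩
        · exact absurd h1 hwv
        · rcases mem_ch_or_of_mem_wiring H.filling hu with h2 | h2
          · exact Or.inr (Or.inr ⟨x, hx, mem_sub_of_mem_ch h1 h2⟩)
          · exact Or.inr (Or.inl h2)
  obtain ⟨c, hc2, hct⟩ : ∃ c, F.lev c = 2 ∧ c ∉ t := by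
    by_contra! hc
    have hsub : (univ.filter fun u => F.lev u ≤ 2) ⊆ F.roots ∪ t := by
      intro u hu
      have h1 := (mem_filter.1 hu).2
      have h2 := F.lev_pos u
      rw [mem_union, mem_roots]
      by_cases hl : F.lev u = 1
      · exact Or.inl hl
      · exact Or.inr (hc u (by omega))
    have h1 := (card_le_card hsub).trans (card_union_le _ _)
    have h2 := F.card_lev_le (i := 2) (by omega)
    rw [H.card_eq, show F.roots.card = k from F.card_roots] at h1
    simp only [moore, hk] at h2
    omega
  have hcb : c ∉ ball (Function.update (F.wiring Y) v t) (d + 1) v := by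
    intro hcb
    rcases hinv' c hcb with rfl | h1 | ⟨x, hx, h1⟩
    · omega
    · omega
    · have := eq_of_mem_sub_of_lev h1 (by rw [ht x hx]; omega)
      exact hct (this ▸ hx)
  obtain ⟨e, he, hev⟩ := exists_mem_ne
    (show 1 < (F.ch c).card by rw [card_ch (by omega)]; omega) v
  have hel := lev_of_mem_ch he
  have heb : e ∈ ball (Function.update (F.wiring Y) v t) (d + 1 + 1) v := H.ball_eq ▸ mem_univ e
  rcases mem_ball_succ.1 heb with heb | ⟨w, hw, hew⟩
  · rcases hinv' e heb with h1 | h1 | ⟨x, hx, h1⟩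
    · exact hev h1
    · omega
    · have hxl := ht x hx
      have := eq_of_common e (mem_sub_of_mem_ch (self_mem_sub c) he) h1 (by omega)
      exact hct (this ▸ hx)
  · by_cases hwv : w = v
    · rw [hwv, Function.update_self] at hew
      have := ht e hew
      omega
    · rw [update_of_ne hwv] at hew
      have hwc : w = c := (eq_par_of_mem_wiring H.filling hew (by omega)).trans (F.mem_ch.1 he).2
      exact hcb (hwc ▸ hw)

lemma false_of_eq_two (hk : k = 2) (hd : 2 ≤ d) : False := by
  by_cases h1 : ∃ r ∈ t, F.lev r = 1
  · obtain ⟨r, hr, hr1⟩ := h1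
    obtain ⟨x, hx, hx2⟩ := H.exists_mem_notMem_roots
    exact H.false_of_root_mem hk hd hr hr1 hx hx2
  · have h2 : ∀ x ∈ t, 2 ≤ F.lev x := fun x hx => by
      have := F.lev_pos x
      have : F.lev x ≠ 1 := fun hc => h1 ⟨x, hx, hc⟩
      omega
    refine H.false_of_lev_eq_two hk hd fun x hx => ?_
    by_contra hne
    have hx2 := h2 x hx
    exact H.false_of_three_le_lev hk hd hx (by omega) fun hx0 => H.false_of_leaf_mem hk hd h2 hx hx0

end IsImproving

/-- Leaves at level `h` play optimally. -/
lemma stableAt_of_leaf (hY : F.IsFilling Y) (hM : h + 2 ≤ M) (hv : F.ch v = ∅) (hlev : F.lev v = h)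
    (hcase : (3 ≤ k ∧ ∀ u, F.lev u = h → (F.ch u).card ≤ 1) ∨ (k = 2 ∧ 3 ≤ h)) :
    StableAt k M (F.wiring Y) v := by
  intro t hvt ht
  by_contra! hlt
  have h2 := F.two_le_lev_of_leaf v hv
  have H := isImproving_of_cost_lt (d := h - 1) hY hM hv hlev (by omega) hvt ht hlt
  rcases hcase with ⟨hk, hs⟩ | ⟨hk, hh⟩
  · exact H.false_of_three_le hk (by omega) hs
  · exact H.false_of_eq_two hk (by omega)

end Forest

lemma sum_le_sum_of_forall_le {ι : Type} {B C : Finset ι} {f g : ι → ℕ} (hc : B.card ≤ C.card)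
    (h : ∀ b ∈ B, ∀ c ∈ C, f b ≤ g c) : ∑ b ∈ B, f b ≤ ∑ c ∈ C, g c := by
  rcases B.eq_empty_or_nonempty with rfl | hB
  · simp
  · obtain ⟨b, hb, hmax⟩ := exists_max_image B f hB
    calc _ ≤ B.card • f b := sum_le_card_nsmul _ _ _ hmax
      _ ≤ C.card • f b := Nat.mul_le_mul_right _ hc
      _ ≤ _ := card_nsmul_le_sum _ _ _ fun c hc => h b hb c hc

namespace Forest

variable [Fintype V] {k h : ℕ} {F : Forest V k h} {Y : V → Finset V} {M : ℕ} {p : V}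

lemma le_of_mem_ball_update (hY : F.IsFilling Y) (hp : F.lev p = h) {t : Finset V} (i : ℕ) :
    ∀ u ∈ ball (Function.update (F.wiring Y) p t) i p, u ∉ insert p (F.ch p) →
      1 + F.lev u ≤ i + ∑ x ∈ t \ F.ch p, if u ∈ F.sub x then F.lev x else 0 := by
  induction i with
  | zero =>
    intro u hu hup
    exact absurd (mem_insert.2 (Or.inl (by simpa [ball] using hu))) hup
  | succ i ih =>
    intro u hu hup
    rcases mem_ball_succ.1 hu with hu | ⟨w, hw, hu⟩
    · have := ih u hu hup
      omega
    · by_cases hwp : w = p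
      · rw [hwp, Function.update_self] at hu
        have hut : u ∈ t \ F.ch p := mem_sdiff.2 ⟨hu, fun hc => hup (mem_insert_of_mem hc)⟩
        have := single_le_sum (f := fun x => if u ∈ F.sub x then F.lev x else 0)
          (fun _ _ => Nat.zero_le _) hut
        simp only [self_mem_sub, if_true] at this
        omega
      · rw [Function.update_of_ne hwp] at hu
        rcases mem_ch_or_of_mem_wiring hY hu with hc | hc
        · have hwB : w ∉ insert p (F.ch p) := by
            rw [mem_insert]
            rintro (h1 | h1)
            · exact hwp h1
            · have := lev_of_mem_ch h1
              have := lev_of_mem_ch hc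
              have := F.lev_le u
              omega
          have h1 := ih w hw hwB
          have h2 := lev_of_mem_ch hc
          have h3 : (∑ x ∈ t \ F.ch p, if w ∈ F.sub x then F.lev x else 0) ≤
              ∑ x ∈ t \ F.ch p, if u ∈ F.sub x then F.lev x else 0 := by
            refine sum_le_sum fun x _ => ?_
            by_cases hx : w ∈ F.sub x
            · rw [if_pos hx, if_pos (mem_sub_of_mem_ch hx hc)]
            · rw [if_neg hx]
              exact Nat.zero_le _
          omega
        · have : i ≠ 0 := by
            rintro rfl
            exact hwp (by simpa [ball] using hw)
          omega

lemma distW_add_le (hY : F.IsFilling Y) (hc : F.ch p ≠ ∅) (hp : F.lev p = h) (u : V) :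
    distW (F.wiring Y) M p u + (∑ r ∈ Y p, if u ∈ F.sub r then 1 else 0) ≤ 1 + F.lev u := by
  have hlu := F.lev_pos u
  by_cases hex : ∃ r ∈ Y p, u ∈ F.sub r
  · obtain ⟨r, hr, hur⟩ := hex
    have hr1 := F.mem_roots.1 (hY.subset p hr)
    have hsum : (∑ x ∈ Y p, if u ∈ F.sub x then 1 else 0) = 1 := by
      rw [sum_eq_single_of_mem r hr fun x hx hne => ?_, if_pos hur]
      refine if_neg fun hux => hne (eq_of_common u hux hur ?_)
      rw [hr1, F.mem_roots.1 (hY.subset p hx)]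
    have hrb : r ∈ ball (F.wiring Y) (0 + 1) p :=
      ball_step (self_mem_ball _ 0 p) (by rw [wiring_of_ne hc]; exact mem_union_right _ hr)
    have := distW_le (M := M) (mem_ball_of_sub ch_subset_wiring u hrb hur)
    omega
  · have hsum : (∑ x ∈ Y p, if u ∈ F.sub x then 1 else 0) = 0 :=
      sum_eq_zero fun x hx => if_neg fun hux => hex ⟨x, hx, hux⟩
    obtain ⟨z, hz⟩ := nonempty_iff_ne_empty.2 hc
    have hz0 : F.ch z = ∅ := ch_eq_empty_of_lev (by rw [lev_of_mem_ch hz, hp])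
    obtain ⟨r, hr, hur⟩ := F.exists_root u
    have hr1 := F.mem_roots.1 hr
    have hrb : r ∈ ball (F.wiring Y) (0 + 1 + 1) p :=
      ball_step (ball_step (self_mem_ball _ 0 p) (ch_subset_wiring p hz))
        (by rwa [wiring_of_leaf hz0])
    have := distW_le (M := M) (mem_ball_of_sub ch_subset_wiring u hrb hur)
    omega

lemma sum_weights_le (hY : F.IsFilling Y) (hc : F.ch p ≠ ∅)
    (hstar : ∀ x r, x ≠ p → x ∉ F.ch p → (F.lev x = 1 → p ∈ F.sub x) → F.lev r = 1 →
      p ∉ F.sub r → F.lev x * (F.sub x \ insert p (F.ch p)).card ≤ (F.sub r).card)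
    {Z : Finset V} (hZp : p ∉ Z) (hZc : Disjoint Z (F.ch p)) (hZ : Z.card ≤ (Y p).card) :
    ∑ x ∈ Z, F.lev x * (F.sub x \ insert p (F.ch p)).card ≤ ∑ r ∈ Y p, (F.sub r).card := by
  set G := F.roots.filter fun r => p ∉ F.sub r with hG
  have hYG : Y p ⊆ G := fun r hr => mem_filter.2 ⟨hY.subset p hr, hY.notMem p r hr⟩
  obtain ⟨W, hAW, hWG, hW⟩ := exists_subsuperset_card_eq (inter_subset_right (s₁ := Z) (s₂ := G))
    ((card_le_card inter_subset_left).trans hZ) (card_le_card hYG)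
  refine le_trans ?_ (hY.max p hc W (hWG.trans (filter_subset _ _))
    (fun r hr => (mem_filter.1 (hWG hr)).2) hW)
  rw [← sum_sdiff (inter_subset_left (s₁ := Z) (s₂ := G)), ← sum_sdiff hAW]
  refine Nat.add_le_add (sum_le_sum_of_forall_le ?_ fun x hx r hr => ?_)
    (sum_le_sum fun x hx => ?_)
  · rw [card_sdiff_of_subset inter_subset_left, card_sdiff_of_subset hAW, hW]
    exact Nat.sub_le_sub_right hZ _
  · obtain ⟨hxZ, hxG⟩ := mem_sdiff.1 hx
    have hr' := mem_filter.1 (hWG (mem_sdiff.1 hr).1)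
    refine hstar x r (ne_of_mem_of_not_mem hxZ hZp) (disjoint_left.1 hZc hxZ) (fun hx1 => ?_)
      (F.mem_roots.1 hr'.1) hr'.2
    by_contra hpx
    exact hxG (mem_inter.2 ⟨hxZ, mem_filter.2 ⟨F.mem_roots.2 hx1, hpx⟩⟩)
  · rw [F.mem_roots.1 (mem_filter.1 (mem_inter.1 hx).2).1, one_mul]
    exact card_le_card sdiff_subset

/-- Nodes at level `h` with some children play optimally if no subtree is worth linking to more
than the trees not containing them. -/
lemma stableAt_of_weights (hY : F.IsFilling Y) (hM : Fintype.card V ^ 2 < M) (hp : F.lev p = h)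
    (hc : F.ch p ≠ ∅)
    (hstar : ∀ x r, x ≠ p → x ∉ F.ch p → (F.lev x = 1 → p ∈ F.sub x) → F.lev r = 1 →
      p ∉ F.sub r → F.lev x * (F.sub x \ insert p (F.ch p)).card ≤ (F.sub r).card) :
    StableAt k M (F.wiring Y) p := by
  intro t hpt ht
  set s' := Function.update (F.wiring Y) p t with hs'
  by_cases hct : F.ch p ⊆ t
  swap
  · obtain ⟨u, hu, hut⟩ := not_subset.1 hct
    have h1 := F.mem_ch.1 hu
    refine cost_le_of_drop_private hM (exists_mem_ball p) ?_ (fun w hw => ?_) hut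
    · rintro rfl
      have := lev_of_mem_ch hu
      omega
    · rw [eq_par_of_mem_wiring hY hw h1.1, h1.2]
  by_cases hr : ∀ u, ∃ i, u ∈ ball s' i p
  swap
  · push Not at hr
    obtain ⟨u, hu⟩ := hr
    exact ((cost_le_sq (exists_mem_ball p)).trans hM.le).trans (le_cost_of_unreachable hu)
  have hpu : ∀ r ∈ Y p, F.sub r \ insert p (F.ch p) = F.sub r := by
    intro r hr
    rw [Finset.sdiff_eq_self_iff_disjoint, disjoint_right]
    intro u hu hur
    rcases mem_insert.1 hu with rfl | hu
    · exact hY.notMem u r hr hur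
    · have hne : u ≠ r := by
        rintro rfl
        have := (F.mem_ch.1 hu).1
        have := F.mem_roots.1 (hY.subset p hr)
        omega
      have := (par_mem_sub hur hne).1
      rw [(F.mem_ch.1 hu).2] at this
      exact hY.notMem p r hr this
  have hsums : ∀ (Z : Finset V) (f : V → ℕ),
      ∑ u ∈ (insert p (F.ch p))ᶜ, (∑ x ∈ Z, if u ∈ F.sub x then f x else 0) =
        ∑ x ∈ Z, f x * (F.sub x \ insert p (F.ch p)).card := by
    intro Z f
    rw [sum_comm]
    refine sum_congr rfl fun x _ => ?_
    rw [← sum_filter, sum_const, smul_eq_mul, mul_comm]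
    congr 2
    ext u
    simp [and_comm]
  have hZ : (t \ F.ch p).card ≤ (Y p).card := by
    rw [card_sdiff_of_subset hct, hY.card p hc]
    exact Nat.sub_le_sub_right ht _
  have hw := sum_weights_le hY hc hstar (Z := t \ F.ch p) (fun hc => hpt (mem_sdiff.1 hc).1)
    disjoint_sdiff.symm hZ
  have hB : ∑ u ∈ insert p (F.ch p), distW (F.wiring Y) M p u ≤
      ∑ u ∈ insert p (F.ch p), distW s' M p u := by
    refine sum_le_sum fun u hu => ?_
    by_cases hup : u = p
    · rw [hup, distW_self]
      exact Nat.zero_le _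
    · have h1 : distW (F.wiring Y) M p u ≤ 0 + 1 := distW_le (ball_step (self_mem_ball _ 0 p)
        (ch_subset_wiring p ((mem_insert.1 hu).resolve_left hup)))
      have h2 : 0 < distW s' M p u := lt_distW (by simpa [ball] using hup) (by omega)
      omega
  have hD : ∑ u ∈ (insert p (F.ch p))ᶜ, (distW (F.wiring Y) M p u +
        ∑ r ∈ Y p, if u ∈ F.sub r then 1 else 0) ≤
      ∑ u ∈ (insert p (F.ch p))ᶜ, (distW s' M p u +
        ∑ x ∈ t \ F.ch p, if u ∈ F.sub x then F.lev x else 0) := by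
    refine sum_le_sum fun u hu => (distW_add_le hY hc hp u).trans ?_
    obtain ⟨i, hi⟩ := hr u
    exact le_of_mem_ball_update hY hp _ u (mem_ball_distW hi) (mem_compl.1 hu)
  rw [sum_add_distrib, sum_add_distrib, hsums, hsums] at hD
  have hYsum : ∑ r ∈ Y p, 1 * (F.sub r \ insert p (F.ch p)).card = ∑ r ∈ Y p, (F.sub r).card :=
    sum_congr rfl fun r hr => by rw [one_mul, hpu r hr]
  rw [hYsum] at hD
  rw [cost_eq_sum, cost_eq_sum, ← sum_add_sum_compl (insert p (F.ch p)),
    ← sum_add_sum_compl (insert p (F.ch p))]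
  omega

/-- The wiring of a forest is stable, under conditions on the nodes at level `h` that are not
full. -/
theorem stable_wiring (hY : F.IsFilling Y) (hM : Fintype.card V ^ 2 < M) (hhM : h + 2 ≤ M)
    (hleaf : ∀ v, F.lev v = h → F.ch v = ∅ →
      (3 ≤ k ∧ ∀ u, F.lev u = h → (F.ch u).card ≤ 1) ∨ (k = 2 ∧ 3 ≤ h))
    (hstar : ∀ p, F.lev p = h → F.ch p ≠ ∅ → (F.ch p).card ≠ k →
      ∀ x r, x ≠ p → x ∉ F.ch p → (F.lev x = 1 → p ∈ F.sub x) → F.lev r = 1 →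
        p ∉ F.sub r → F.lev x * (F.sub x \ insert p (F.ch p)).card ≤ (F.sub r).card) :
    IsWiring k (F.wiring Y) ∧ Stable k M (F.wiring Y) := by
  refine ⟨fun v => ⟨self_notMem_wiring hY v, (card_wiring hY v).le⟩, fun v => ?_⟩
  change StableAt k M (F.wiring Y) v
  have := F.lev_le v
  rcases Nat.lt_trichotomy (F.lev v) h with hv | hv | hv
  · exact stableAt_of_full hY hM (card_ch hv)
  · by_cases hc : F.ch v = ∅
    · exact stableAt_of_leaf hY hhM hc hv (hleaf v hv hc)
    · by_cases hk : (F.ch v).card = k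
      · exact stableAt_of_full hY hM hk
      · exact stableAt_of_weights hY hM hv hc (hstar v hv hc hk)
  · exact stableAt_of_lev_eq hY hhM (by omega)

end Forest

lemma card_filter_mod {r : ℕ} (m : ℕ) {v : ℕ} (hv : v < r) :
    ((range m).filter fun y => y % r = v).card = m / r + if v < m % r then 1 else 0 := by
  have h := Nat.count_modEq_card m (v := v) (Nat.zero_lt_of_lt hv)
  rw [Nat.mod_eq_of_lt hv, Nat.count_eq_card_filter_range] at h
  rw [← h]
  congr 1
  ext y
  simp [Nat.ModEq, Nat.mod_eq_of_lt hv]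

/-- Nodes of the forest: pairs of a level, counted from `0`, and a position in it. -/
abbrev Node (k h m : ℕ) : Type := Σ i : Fin (h + 1), Fin (if (i : ℕ) < h then k ^ ((i : ℕ) + 1) else m)

namespace Node

variable {k h m : ℕ}

/-- The level of a node, counted from `0`. -/
def idx (v : Node k h m) : ℕ := v.1

/-- The position of a node in its level. -/
def pos (v : Node k h m) : ℕ := v.2

/-- The node with given level and position. -/
def mk (i x : ℕ) (hi : i ≤ h) (hx : x < if i < h then k ^ (i + 1) else m) : Node k h m :=
  ⟨⟨i, Nat.lt_succ_of_le hi⟩, ⟨x, hx⟩⟩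

@[simp] lemma idx_mk {i x : ℕ} (hi : i ≤ h) (hx : x < if i < h then k ^ (i + 1) else m) :
    (mk i x hi hx).idx = i := rfl

@[simp] lemma pos_mk {i x : ℕ} (hi : i ≤ h) (hx : x < if i < h then k ^ (i + 1) else m) :
    (mk i x hi hx).pos = x := rfl

lemma idx_le (v : Node k h m) : v.idx ≤ h := Nat.lt_succ_iff.1 v.1.2

lemma pos_lt (v : Node k h m) : v.pos < if v.idx < h then k ^ (v.idx + 1) else m := v.2.2

lemma ext' {v w : Node k h m} (h1 : v.idx = w.idx) (h2 : v.pos = w.pos) : v = w := by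
  obtain ⟨⟨i, hi⟩, ⟨x, hx⟩⟩ := v
  obtain ⟨⟨j, hj⟩, ⟨y, hy⟩⟩ := w
  simp only [idx, pos] at h1 h2
  subst h1
  subst h2
  rfl

lemma card_filter (P : ℕ → ℕ → Prop) [∀ i x, Decidable (P i x)] :
    (univ.filter fun v : Node k h m => P v.idx v.pos).card =
      ∑ i ∈ range h, ((range (k ^ (i + 1))).filter fun x => P i x).card +
        ((range m).filter fun x => P h x).card := by
  rw [Finset.card_filter, Fintype.sum_sigma]
  have : ∀ i : Fin (h + 1), (∑ x : Fin (if (i : ℕ) < h then k ^ ((i : ℕ) + 1) else m),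
      if P (idx (⟨i, x⟩ : Node k h m)) (pos (⟨i, x⟩ : Node k h m)) then 1 else 0) =
      ((range (if (i : ℕ) < h then k ^ ((i : ℕ) + 1) else m)).filter fun x => P i x).card := by
    intro i
    rw [Finset.card_filter, ← Fin.sum_univ_eq_sum_range (fun x => if P i x then 1 else 0)]
    rfl
  rw [sum_congr rfl fun i _ => this i, Fin.sum_univ_eq_sum_range (fun i =>
    ((range (if i < h then k ^ (i + 1) else m)).filter fun x => P i x).card), sum_range_succ]
  congr 1
  · refine sum_congr rfl fun i hi => ?_
    rw [if_pos (mem_range.1 hi)]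
  · rw [if_neg (lt_irrefl h)]

lemma card_eq : Fintype.card (Node k h m) = ∑ i ∈ range h, k ^ (i + 1) + m := by
  rw [← card_univ, ← filter_true (s := (univ : Finset (Node k h m)))]
  rw [card_filter (fun _ _ => True)]
  simp

/-- The position of the ancestor of the `x`-th node of level `i` at a higher level is given by
the remainders of this number. -/
def addr (h : ℕ) (φ : ℕ → ℕ) (i x : ℕ) : ℕ := if i < h then x else φ x

variable {φ : ℕ → ℕ}

/-- The parent of a node; roots are their own parents. -/
def par (hk : 1 ≤ k) (φ : ℕ → ℕ) (v : Node k h m) : Node k h m :=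
  if hv : v.idx = 0 then v else
    mk (v.idx - 1) (addr h φ v.idx v.pos % k ^ v.idx) ((Nat.sub_le _ _).trans v.idx_le) (by
      have := v.idx_le
      rw [if_pos (by omega), Nat.sub_add_cancel (by omega)]
      exact Nat.mod_lt _ (Nat.pow_pos hk))

lemma idx_par (hk : 1 ≤ k) {v : Node k h m} (hv : v.idx ≠ 0) : (par hk φ v).idx = v.idx - 1 := by
  rw [par, dif_neg hv, idx_mk]

lemma pos_par (hk : 1 ≤ k) {v : Node k h m} (hv : v.idx ≠ 0) :
    (par hk φ v).pos = addr h φ v.idx v.pos % k ^ v.idx := by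
  rw [par, dif_neg hv, pos_mk]

/-- The subtree below a node. -/
def sub (φ : ℕ → ℕ) (v : Node k h m) : Finset (Node k h m) :=
  univ.filter fun u => (u.idx = v.idx ∧ u.pos = v.pos) ∨
    (v.idx < u.idx ∧ addr h φ u.idx u.pos % k ^ (v.idx + 1) = v.pos)

lemma mem_sub {u v : Node k h m} : u ∈ sub φ v ↔ (u.idx = v.idx ∧ u.pos = v.pos) ∨
    (v.idx < u.idx ∧ addr h φ u.idx u.pos % k ^ (v.idx + 1) = v.pos) := by
  simp [sub]

lemma mem_sub_iff (hk : 1 ≤ k) (s u : Node k h m) :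
    u ∈ sub φ s ↔ u = s ∨ (2 ≤ u.idx + 1 ∧ par hk φ u ∈ sub φ s) := by
  rw [mem_sub]
  have heq : u = s ↔ u.idx = s.idx ∧ u.pos = s.pos :=
    ⟨fun h => h ▸ ⟨rfl, rfl⟩, fun h => ext' h.1 h.2⟩
  rw [heq]
  by_cases hu : u.idx = 0
  · simp [hu]
  · rw [mem_sub, idx_par hk hu, pos_par hk hu]
    refine or_congr_right ?_
    have hul := u.idx_le
    constructor
    · rintro ⟨h1, h2⟩
      refine ⟨by omega, ?_⟩
      by_cases h3 : u.idx = s.idx + 1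
      · exact Or.inl ⟨by omega, by rw [← h2, h3]⟩
      · refine Or.inr ⟨by omega, ?_⟩
        rw [← h2]
        nth_rewrite 1 [addr]
        rw [if_pos (by omega), Nat.mod_mod_of_dvd _ (pow_dvd_pow k (by omega))]
    · rintro ⟨-, ⟨h1, h2⟩ | ⟨h1, h2⟩⟩
      · have h3 : u.idx = s.idx + 1 := by omega
        exact ⟨by omega, by rw [← h2, h3]⟩
      · refine ⟨by omega, ?_⟩
        rw [← h2]
        nth_rewrite 2 [addr]
        rw [if_pos (by omega), Nat.mod_mod_of_dvd _ (pow_dvd_pow k (by omega))]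

lemma filter_children (hk : 1 ≤ k) (v : Node k h m) :
    (univ.filter fun u : Node k h m => 2 ≤ u.idx + 1 ∧ par hk φ u = v) =
      univ.filter fun u : Node k h m =>
        u.idx = v.idx + 1 ∧ addr h φ u.idx u.pos % k ^ (v.idx + 1) = v.pos := by
  ext u
  simp only [mem_filter, mem_univ, true_and]
  constructor
  · rintro ⟨h1, rfl⟩
    have hu : u.idx ≠ 0 := by omega
    rw [idx_par hk hu, pos_par hk hu, Nat.sub_add_cancel (by omega)]
    exact ⟨rfl, rfl⟩
  · rintro ⟨h1, h2⟩
    have hu : u.idx ≠ 0 := by omega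
    exact ⟨by omega, ext' (by rw [idx_par hk hu]; omega) (by rw [pos_par hk hu, ← h2, h1])⟩

lemma card_filter_mod_pow (hk : 1 ≤ k) {i j x : ℕ} (hij : i ≤ j) (hx : x < k ^ i) :
    ((range (k ^ j)).filter fun y => y % k ^ i = x).card = k ^ (j - i) := by
  rw [card_filter_mod _ hx, ← Nat.sub_add_cancel hij, pow_add,
    Nat.mul_div_cancel _ (Nat.pow_pos hk), Nat.mul_mod_left, if_neg (Nat.not_lt_zero _)]
  simp

lemma card_children_of_lt (hk : 1 ≤ k) {v : Node k h m} (hv : v.idx + 1 < h) :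
    (univ.filter fun u : Node k h m => 2 ≤ u.idx + 1 ∧ par hk φ u = v).card = k := by
  rw [filter_children, card_filter (fun i x => i = v.idx + 1 ∧ addr h φ i x % k ^ (v.idx + 1) = v.pos)]
  have h1 : ((range m).filter fun x => h = v.idx + 1 ∧
      addr h φ h x % k ^ (v.idx + 1) = v.pos).card = 0 := by
    rw [card_eq_zero, filter_eq_empty_iff]
    rintro x - ⟨h1, -⟩
    omega
  rw [h1, add_zero, sum_eq_single_of_mem (v.idx + 1) (mem_range.2 hv)]
  · have hp := v.pos_lt
    rw [if_pos (by omega)] at hp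
    have := card_filter_mod_pow hk (Nat.le_succ (v.idx + 1)) hp
    rw [Nat.succ_sub (le_refl _), Nat.sub_self, pow_one] at this
    refine Eq.trans ?_ this
    congr 1
    ext y
    simp [addr, hv]
  · intro i _ hi
    rw [card_eq_zero, filter_eq_empty_iff]
    rintro x - ⟨h1, -⟩
    exact hi h1

lemma card_children_of_eq (hk : 1 ≤ k) {v : Node k h m} (hv : v.idx + 1 = h) :
    (univ.filter fun u : Node k h m => 2 ≤ u.idx + 1 ∧ par hk φ u = v).card =
      ((range m).filter fun y => φ y % k ^ h = v.pos).card := by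
  rw [filter_children, card_filter (fun i x => i = v.idx + 1 ∧ addr h φ i x % k ^ (v.idx + 1) = v.pos)]
  rw [sum_eq_zero, zero_add]
  · congr 1
    ext y
    simp [addr, hv]
  · intro i hi
    rw [card_eq_zero, filter_eq_empty_iff]
    rintro x - ⟨h1, -⟩
    have := mem_range.1 hi
    omega

lemma card_roots : (univ.filter fun v : Node k (h + 1) m => v.idx + 1 = 1).card = k := by
  rw [card_filter (fun i _ => i + 1 = 1), sum_range_succ']
  simp

lemma card_sub_of_lt (hk : 1 ≤ k) {v : Node k h m} (hv : v.idx < h) :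
    (sub φ v).card = ∑ j ∈ range (h - v.idx), k ^ j +
      ((range m).filter fun y => φ y % k ^ (v.idx + 1) = v.pos).card := by
  have hp := v.pos_lt
  rw [if_pos hv] at hp
  rw [sub, card_filter (fun i x => (i = v.idx ∧ x = v.pos) ∨
    (v.idx < i ∧ addr h φ i x % k ^ (v.idx + 1) = v.pos))]
  congr 1
  · rw [← sum_range_add_sum_Ico _ hv.le, sum_eq_zero, zero_add, sum_Ico_eq_sum_range]
    · refine sum_congr rfl fun j hj => ?_
      have hj' := mem_range.1 hj
      have hc := card_filter_mod_pow hk (show v.idx + 1 ≤ v.idx + j + 1 by omega) hp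
      rw [show v.idx + j + 1 - (v.idx + 1) = j by omega] at hc
      rw [← hc]
      congr 1
      refine filter_congr fun y hy => ?_
      rw [addr, if_pos (by omega)]
      rcases Nat.eq_zero_or_pos j with rfl | hj0
      · rw [add_zero, Nat.mod_eq_of_lt (mem_range.1 hy)]
        simp
      · constructor
        · rintro (⟨h1, -⟩ | ⟨-, h1⟩)
          · omega
          · exact h1
        · exact fun h1 => Or.inr ⟨by omega, h1⟩
    · intro i hi
      rw [card_eq_zero, filter_eq_empty_iff]
      have := mem_range.1 hi
      rintro x - (⟨h1, -⟩ | ⟨h1, -⟩) <;> omega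
  · congr 1
    ext y
    simp [addr, hv, hv.ne']

lemma card_sub_of_eq {v : Node k h m} (hv : v.idx = h) : (sub φ v).card = 1 := by
  rw [card_eq_one]
  refine ⟨v, ?_⟩
  ext u
  rw [mem_sub, mem_singleton]
  have := u.idx_le
  constructor
  · rintro (⟨h1, h2⟩ | ⟨h1, -⟩)
    · exact ext' h1 h2
    · omega
  · rintro rfl
    exact Or.inl ⟨rfl, rfl⟩

/-- The forest of nodes, in which the `y`-th node of the last level has parent number `φ y`. -/
def forest (m : ℕ) {k h : ℕ} (φ : ℕ → ℕ) (hk : 1 ≤ k) (hh : 1 ≤ h) (h2 : 2 ≤ h ∨ k = 1 ∧ 1 ≤ m)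
    (hfib : ∀ x, ((range m).filter fun y => φ y % k ^ h = x).card ≤ k) :
    Forest (Node k h m) k h where
  lev v := v.idx + 1
  par := par hk φ
  sub := sub φ
  lev_pos v := Nat.le_add_left 1 _
  lev_le v := Nat.succ_le_succ v.idx_le
  lev_par v hv := by
    rw [idx_par hk (by omega)]
    omega
  mem_sub := mem_sub_iff hk
  card_roots := by
    obtain ⟨h, rfl⟩ := Nat.exists_eq_add_of_le' hh
    exact card_roots
  card_children v hv := card_children_of_lt hk hv
  card_children_le v hv := (card_children_of_eq hk hv).trans_le (hfib _)
  two_le_lev_of_leaf v hv := by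
    by_contra hc
    rcases lt_or_ge 1 h with h1 | h1
    · have := card_children_of_lt (φ := φ) hk (v := v) (by omega)
      rw [hv, card_empty] at this
      omega
    · obtain ⟨rfl, hm⟩ := h2.resolve_left (by omega)
      have h3 := card_children_of_eq (φ := φ) hk (v := v) (by omega)
      have hp := v.pos_lt
      rw [if_pos (by omega), one_pow] at hp
      rw [hv, card_empty, eq_comm, card_eq_zero, filter_eq_empty_iff] at h3
      refine h3 (mem_range.2 hm) ?_
      rw [one_pow, Nat.mod_one]
      omega

end Node

lemma sum_pow_eq (k : ℕ) {i h : ℕ} (hi : i ≤ h) :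
    ∑ j ∈ range h, k ^ j = k ^ i * ∑ j ∈ range (h - i), k ^ j + ∑ j ∈ range i, k ^ j := by
  rw [← sum_range_add_sum_Ico _ hi, sum_Ico_eq_sum_range, mul_sum, add_comm]
  simp only [pow_add]

lemma one_le_sum_pow (k : ℕ) {i : ℕ} (hi : 1 ≤ i) : 1 ≤ ∑ j ∈ range i, k ^ j := by
  obtain ⟨i, rfl⟩ := Nat.exists_eq_add_of_le' hi
  rw [sum_range_succ', pow_zero]
  exact Nat.le_add_left _ _

lemma sum_two_pow (i : ℕ) : ∑ j ∈ range i, 2 ^ j + 1 = 2 ^ i := by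
  induction i with
  | zero => rfl
  | succ i ih => rw [sum_range_succ, pow_succ]; omega

lemma succ_le_sum_pow {k h : ℕ} (hk : 2 ≤ k) (hh : 2 ≤ h) : h + 1 ≤ ∑ j ∈ range h, k ^ j := by
  induction h, hh using Nat.le_induction with
  | base => simp only [sum_range_succ, range_zero, sum_empty, pow_zero, pow_one]; omega
  | succ h _ ih =>
    rw [sum_range_succ]
    have := Nat.pow_pos (n := h) (show 0 < k by omega)
    omega

lemma add_two_le_two_pow {i : ℕ} (hi : 2 ≤ i) : i + 2 ≤ 2 ^ i := by
  induction i, hi using Nat.le_induction with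
  | base => norm_num
  | succ h _ ih => rw [pow_succ]; omega

lemma two_mul_add_two_le_two_pow {i : ℕ} (hi : 3 ≤ i) : 2 * i + 2 ≤ 2 ^ i := by
  induction i, hi using Nat.le_induction with
  | base => norm_num
  | succ h _ ih => rw [pow_succ]; omega

lemma two_mul_succ_le_pow {k i : ℕ} (hk : 3 ≤ k) (hi : 1 ≤ i) : 2 * i + 1 ≤ k ^ i := by
  induction i, hi using Nat.le_induction with
  | base => rw [pow_one]; omega
  | succ h _ ih => rw [pow_succ]; nlinarith

lemma card_filter_mod_eight (P : ℕ → Prop) [DecidablePred P] (q r : ℕ) (hr : r ≤ 8) :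
    ((range (8 * q + r)).filter fun y => P (y % 8)).card =
      q * ((range 8).filter P).card + ((range r).filter P).card := by
  have h8 : ∀ s ≤ 8, ((range s).filter fun y => P (y % 8)).card = ((range s).filter P).card := by
    intro s hs
    congr 1
    refine filter_congr fun y hy => ?_
    rw [Nat.mod_eq_of_lt ((mem_range.1 hy).trans_le hs)]
  induction q with
  | zero => simpa using h8 r hr
  | succ q ih =>
    rw [← Nat.count_eq_card_filter_range] at ih ⊢
    rw [show 8 * (q + 1) + r = 8 + (8 * q + r) by ring, Nat.count_add]
    simp only [Nat.add_mod_left]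
    rw [ih, Nat.count_eq_card_filter_range, h8 8 le_rfl]
    ring

/-- The number of nodes of the last level below the `a`-th node of level `i`. -/
def below (k m : ℕ) (φ : ℕ → ℕ) (i a : ℕ) : ℕ :=
  ((range m).filter fun y => φ y % k ^ (i + 1) = a).card

/-- The arithmetic form of the stability condition at nodes with some but not all children. -/
def IsBalanced (k h m : ℕ) (φ : ℕ → ℕ) : Prop :=
  ∀ c < k ^ h, ((range m).filter fun y => φ y % k ^ h = c).card ≠ 0 →
    ((range m).filter fun y => φ y % k ^ h = c).card ≠ k → ∀ b < k, c % k ≠ b →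
      below k m φ 0 (c % k) ≤ below k m φ 0 b + 2 ∧
      ∀ i, 1 ≤ i → i < h → ∀ a < k ^ (i + 1),
        (i + 1) * (∑ j ∈ range (h - i), k ^ j + below k m φ i a) ≤
          ∑ j ∈ range h, k ^ j + below k m φ 0 b + if c % k ^ (i + 1) = a then 2 * (i + 1) else 0

namespace Node

variable {k h m : ℕ} {φ : ℕ → ℕ}

lemma stable_condition (hk : 1 ≤ k) (hh : 1 ≤ h) (h2 : 2 ≤ h ∨ k = 1 ∧ 1 ≤ m)
    (hfib : ∀ x, ((range m).filter fun y => φ y % k ^ h = x).card ≤ k)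
    (hφ : 2 ≤ k → IsBalanced k h m φ) {F : Forest (Node k h m) k h}
    (hF : F = forest m φ hk hh h2 hfib) :
    ∀ p, F.lev p = h → F.ch p ≠ ∅ → (F.ch p).card ≠ k →
      ∀ x r, x ≠ p → x ∉ F.ch p → (F.lev x = 1 → p ∈ F.sub x) → F.lev r = 1 →
        p ∉ F.sub r → F.lev x * (F.sub x \ insert p (F.ch p)).card ≤ (F.sub r).card := by
  intro p hp hc hck x r hxp hxc hx1 hr hpr
  have hc1 : 1 ≤ (F.ch p).card := card_pos.2 (nonempty_iff_ne_empty.2 hc)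
  have hk2 : 2 ≤ k := by
    have := F.card_ch_le p
    omega
  have h2 : 2 ≤ h := by omega
  have hlev : ∀ v : Node k h m, F.lev v = v.idx + 1 := by
    rw [hF]
    exact fun _ => rfl
  have hsub : ∀ v : Node k h m, F.sub v = sub φ v := by
    rw [hF]
    exact fun _ => rfl
  rw [hlev] at hp hr
  have hcard : (F.ch p).card = ((range m).filter fun y => φ y % k ^ h = p.pos).card := by
    rw [hF]
    exact card_children_of_eq hk hp
  have hppos := p.pos_lt
  rw [if_pos (by omega), hp] at hppos
  have hrpos := r.pos_lt
  rw [if_pos (by omega), show r.idx + 1 = 1 by omega, pow_one] at hrpos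
  have hpsub : ∀ v : Node k h m, v.idx + 1 < h → (p ∈ sub φ v ↔ p.pos % k ^ (v.idx + 1) = v.pos) := by
    intro v hv
    rw [mem_sub, addr, if_pos (by omega)]
    constructor
    · rintro (⟨h1, -⟩ | ⟨-, h1⟩)
      · omega
      · exact h1
    · exact fun h1 => Or.inr ⟨by omega, h1⟩
  have hcb : p.pos % k ≠ r.pos := by
    rw [hsub, hpsub r (by omega), show r.idx + 1 = 1 by omega, pow_one] at hpr
    exact hpr
  obtain ⟨h0, hi⟩ := hφ hk2 p.pos hppos (by omega) (by omega) r.pos hrpos hcb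
  have hrcard : (F.sub r).card = ∑ j ∈ range h, k ^ j + below k m φ 0 r.pos := by
    rw [hsub, card_sub_of_lt hk (by omega), show r.idx = 0 by omega]
    rfl
  have hmin : p ∈ F.sub x → (F.sub x \ insert p (F.ch p)).card + 2 ≤ (F.sub x).card := by
    intro hpx
    have hs : insert p (F.ch p) ⊆ F.sub x := by
      refine insert_subset hpx fun u hu => ?_
      have hu' := F.mem_ch.1 hu
      exact (F.mem_sub x u).2 (Or.inr ⟨hu'.1, hu'.2 ▸ hpx⟩)
    have hpc : p ∉ F.ch p := by
      intro h3
      have := F.lev_of_mem_ch h3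
      omega
    have h3 := card_sdiff_add_card_eq_card hs
    rw [card_insert_of_notMem hpc] at h3
    omega
  have hle : (F.sub x \ insert p (F.ch p)).card ≤ (F.sub x).card := card_le_card sdiff_subset
  rw [hrcard, hlev]
  have hxl := x.idx_le
  rcases Nat.eq_zero_or_pos x.idx with hx0 | hx0
  · have hpx := hx1 (by rw [hlev, hx0])
    have h3 := hmin hpx
    have h4 := (hpsub x (by omega)).1 (by rwa [hsub] at hpx)
    rw [hx0, zero_add, pow_one] at h4
    rw [hsub, card_sub_of_lt hk (by omega), hx0] at h3
    change _ ≤ _ + below k m φ 0 x.pos at h3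
    rw [← h4] at h3
    rw [hx0, zero_add, one_mul]
    rw [hsub]
    simp only [Nat.sub_zero] at h3
    omega
  rcases hxl.lt_or_eq with hxh | hxh
  · have hxpos := x.pos_lt
    rw [if_pos hxh] at hxpos
    have h3 := hi x.idx hx0 hxh x.pos hxpos
    have h4 : (F.sub x).card = ∑ j ∈ range (h - x.idx), k ^ j + below k m φ x.idx x.pos := by
      rw [hsub, card_sub_of_lt hk hxh]
      rfl
    rw [← h4] at h3
    split_ifs at h3 with h5
    · have h6 : x.idx + 1 < h := by
        by_contra h6
        have h7 : x.idx + 1 = h := by omega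
        rw [h7, Nat.mod_eq_of_lt hppos] at h5
        exact hxp (ext' (by omega) h5.symm)
      have h7 := hmin (by rw [hsub]; exact (hpsub x h6).2 h5)
      have h8 := Nat.mul_le_mul_left (x.idx + 1) h7
      rw [mul_add] at h8
      omega
    · exact (Nat.mul_le_mul_left _ hle).trans (by omega)
  · have h3 : (F.sub x).card = 1 := by rw [hsub, card_sub_of_eq hxh]
    have h4 := succ_le_sum_pow hk2 h2
    have h5 := Nat.mul_le_mul_left (x.idx + 1) (hle.trans_eq h3)
    omega

end Node

section Cyclic

variable {k h m : ℕ}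

lemma below_cyclic {i a : ℕ} (hi : i < h) (ha : a < k ^ (i + 1)) :
    below k m (fun y => y % k ^ h) i a =
      m / k ^ (i + 1) + if a < m % k ^ (i + 1) then 1 else 0 := by
  rw [below, ← card_filter_mod m ha]
  simp only [Nat.mod_mod_of_dvd _ (pow_dvd_pow k (show i + 1 ≤ h from hi))]

lemma card_fiber_cyclic (hm : m ≤ k ^ (h + 1)) (hk : 1 ≤ k) (x : ℕ) :
    ((range m).filter fun y => y % k ^ h % k ^ h = x).card ≤ k := by
  simp only [Nat.mod_mod]
  have hpos : 0 < k ^ h := Nat.pow_pos hk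
  rcases lt_or_ge x (k ^ h) with hx | hx
  · calc _ ≤ ((range (k ^ (h + 1))).filter fun y => y % k ^ h = x).card :=
          card_le_card (filter_subset_filter _ (range_subset_range.2 hm))
      _ = k := by
        rw [card_filter_mod _ hx, pow_succ', Nat.mul_div_cancel _ hpos, Nat.mul_mod_left,
          if_neg (Nat.not_lt_zero _), add_zero]
  · rw [filter_false_of_mem, card_empty]
    · exact Nat.zero_le _
    · rintro y - rfl
      exact absurd (Nat.mod_lt y hpos) (not_lt.2 hx)

lemma pow_mul_div_le (i : ℕ) (hk : 1 ≤ k) : k ^ i * (m / k ^ (i + 1)) ≤ m / k := by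
  rw [Nat.le_div_iff_mul_le hk, mul_right_comm, ← pow_succ]
  exact Nat.mul_div_le _ _

lemma isBalanced_cyclic (hk : 3 ≤ k ∨ k = 2 ∧ m % 4 ≠ 1) (hh : 1 ≤ h) :
    IsBalanced k h m fun y => y % k ^ h := by
  have hk2 : 2 ≤ k := by omega
  intro c _ _ _ b hb _
  have hb0 : m / k ≤ below k m (fun y => y % k ^ h) 0 b := by
    rw [below_cyclic hh (by simpa using hb), zero_add, pow_one]
    exact Nat.le_add_right _ _
  refine ⟨?_, fun i hi hih a ha => le_trans ?_ (Nat.le_add_right _ _)⟩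
  · rw [below_cyclic hh (by simpa using Nat.mod_lt c (by omega)), zero_add, pow_one]
    split_ifs <;> omega
  · have hq := pow_mul_div_le (m := m) i (show 1 ≤ k by omega)
    have hbel := below_cyclic (m := m) hih ha
    have hbel' : below k m (fun y => y % k ^ h) i a ≤ m / k ^ (i + 1) + 1 := by
      rw [hbel]
      split_ifs <;> omega
    rw [sum_pow_eq k hih.le]
    have hG : 1 ≤ ∑ j ∈ range (h - i), k ^ j := one_le_sum_pow k (by omega)
    have hg := one_le_sum_pow k hi
    refine le_trans ?_ (Nat.add_le_add_left hb0 _)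
    rcases hk with hk | ⟨rfl, hm⟩
    · have := two_mul_succ_le_pow hk hi
      generalize below k m (fun y => y % k ^ h) i a = B at *
      generalize k ^ i = K at *
      generalize m / k ^ (i + 1) = Q at *
      generalize (∑ j ∈ range (h - i), k ^ j) = G at *
      nlinarith
    · rcases hi.lt_or_eq with hi2 | rfl
      · have := add_two_le_two_pow hi2
        have := sum_two_pow i
        generalize below 2 m (fun y => y % 2 ^ h) i a = B at *
        generalize 2 ^ i = K at *
        generalize m / 2 ^ (i + 1) = Q at *
        generalize (∑ j ∈ range (h - i), 2 ^ j) = G at *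
        nlinarith
      · norm_num at hbel ⊢
        split_ifs at hbel <;> omega

end Cyclic

/-- The permutation of the natural numbers exchanging `4 * q + 1` and `4 * q + 2`. -/
def shuffle (z : ℕ) : ℕ := if z % 4 = 1 then z + 1 else if z % 4 = 2 then z - 1 else z

lemma shuffle_injective : Function.Injective shuffle := by
  intro z z' hz
  simp only [shuffle] at hz
  split_ifs at hz <;> omega

lemma shuffle_mod (z P : ℕ) (hP : 0 < P) : shuffle z % (4 * P) = shuffle (z % (4 * P)) := by
  have h1 := Nat.div_add_mod z (4 * P)
  rw [mul_assoc] at h1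
  have h2 := Nat.mod_lt z (show 0 < 4 * P by omega)
  generalize z % (4 * P) = r at *
  have h3 : shuffle r < 4 * P := by
    simp only [shuffle]
    split_ifs <;> omega
  have h4 : shuffle z = shuffle r + 4 * P * (z / (4 * P)) := by
    rw [mul_assoc]
    generalize P * (z / (4 * P)) = w at *
    simp only [shuffle]
    split_ifs <;> omega
  rw [h4, Nat.add_mul_mod_self_left, Nat.mod_eq_of_lt h3]

lemma shuffle_mod_two_pow (z : ℕ) {j : ℕ} (hj : 2 ≤ j) :
    shuffle z % 2 ^ j = shuffle (z % 2 ^ j) := by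
  obtain ⟨j, rfl⟩ := Nat.exists_eq_add_of_le hj
  rw [pow_add]
  exact shuffle_mod z _ (Nat.pow_pos two_pos)

section Shuffled

variable {h m : ℕ}

lemma filter_shuffle_subset (hh : 2 ≤ h) {y₀ c : ℕ} (h0 : shuffle (y₀ / 2) % 2 ^ h = c) :
    ((range m).filter fun y => shuffle (y / 2) % 2 ^ h = c) =
      (range m).filter fun y => y / 2 % 2 ^ h = y₀ / 2 % 2 ^ h := by
  refine filter_congr fun y _ => ?_
  rw [← h0, shuffle_mod_two_pow _ hh, shuffle_mod_two_pow _ hh]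
  exact shuffle_injective.eq_iff

lemma filter_div_two_mod (hh : 2 ≤ h) (hm : m ≤ 2 ^ (h + 1)) {y₀ c : ℕ} (hy₀ : y₀ < m)
    (h0 : shuffle (y₀ / 2) % 2 ^ h = c) :
    ((range m).filter fun y => shuffle (y / 2) % 2 ^ h = c) =
      (range m).filter fun y => y = y₀ / 2 * 2 ∨ y = y₀ / 2 * 2 + 1 := by
  rw [filter_shuffle_subset hh h0]
  refine filter_congr fun y hy => ?_
  have := mem_range.1 hy
  rw [pow_succ] at hm
  rw [Nat.mod_eq_of_lt (by omega), Nat.mod_eq_of_lt (by omega)]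
  omega

lemma card_fiber_shuffled (hh : 2 ≤ h) (hm : m ≤ 2 ^ (h + 1)) (c : ℕ) :
    ((range m).filter fun y => shuffle (y / 2) % 2 ^ h = c).card ≤ 2 := by
  rcases ((range m).filter fun y => shuffle (y / 2) % 2 ^ h = c).eq_empty_or_nonempty with h0 | h0
  · rw [h0]
    exact Nat.zero_le _
  · obtain ⟨y, hy⟩ := h0
    obtain ⟨hy1, hy2⟩ := mem_filter.1 hy
    rw [filter_div_two_mod hh hm (mem_range.1 hy1) hy2]
    refine (card_le_card (t := {y / 2 * 2, y / 2 * 2 + 1}) fun u hu => ?_).trans card_le_two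
    simpa using (mem_filter.1 hu).2

lemma below_shuffled_le {i a : ℕ} (hi : 1 ≤ i) :
    below 2 m (fun y => shuffle (y / 2)) i a ≤ 2 * (m / 2 ^ (i + 2)) + 2 := by
  rw [below]
  rcases ((range m).filter fun y => shuffle (y / 2) % 2 ^ (i + 1) = a).eq_empty_or_nonempty
    with h0 | h0
  · rw [h0]
    exact Nat.zero_le _
  · obtain ⟨y, hy⟩ := h0
    rw [filter_shuffle_subset (by omega) (mem_filter.1 hy).2]
    have hP : 0 < 2 ^ (i + 1) := Nat.pow_pos two_pos
    have hlt := Nat.mod_lt (y / 2) hP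
    generalize y / 2 % 2 ^ (i + 1) = x at *
    have hx : ∀ v < 2 ^ (i + 2), ((range m).filter fun y => y % 2 ^ (i + 2) = v).card ≤
        m / 2 ^ (i + 2) + 1 := by
      intro v hv
      rw [card_filter_mod m hv]
      split_ifs <;> omega
    have hpow : 2 ^ (i + 2) = 2 * 2 ^ (i + 1) := by ring
    have h1 := hx (2 * x) (by omega)
    have h2 := hx (2 * x + 1) (by omega)
    refine (card_le_card (t := ((range m).filter fun y => y % 2 ^ (i + 2) = 2 * x) ∪
      ((range m).filter fun y => y % 2 ^ (i + 2) = 2 * x + 1)) fun u hu => ?_).trans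
      ((card_union_le _ _).trans (by omega))
    obtain ⟨h3, h4⟩ := mem_filter.1 hu
    rw [mem_union, mem_filter, mem_filter, hpow, Nat.mod_mul]
    refine (Nat.mod_two_eq_zero_or_one u).imp (fun h5 => ⟨h3, by omega⟩) fun h5 => ⟨h3, by omega⟩

lemma below_shuffled_zero (q r b : ℕ) (hr : r ≤ 8) :
    below 2 (8 * q + r) (fun y => shuffle (y / 2)) 0 b =
      q * ((range 8).filter fun y => shuffle (y / 2) % 2 = b).card +
        ((range r).filter fun y => shuffle (y / 2) % 2 = b).card := by
  rw [← card_filter_mod_eight _ q r hr, below]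
  congr 1
  refine filter_congr fun y _ => ?_
  have : shuffle (y / 2) % 2 = shuffle (y % 8 / 2) % 2 := by
    simp only [shuffle]
    split_ifs <;> omega
  rw [zero_add, pow_one, this]

lemma below_shuffled_one (q r a : ℕ) (hr : r ≤ 8) :
    below 2 (8 * q + r) (fun y => shuffle (y / 2)) 1 a =
      q * ((range 8).filter fun y => shuffle (y / 2) % 4 = a).card +
        ((range r).filter fun y => shuffle (y / 2) % 4 = a).card := by
  rw [← card_filter_mod_eight _ q r hr, below]
  congr 1
  refine filter_congr fun y _ => ?_
  have : shuffle (y / 2) % 4 = shuffle (y % 8 / 2) % 4 := by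
    simp only [shuffle]
    split_ifs <;> omega
  rw [show 2 ^ (1 + 1) = 4 from rfl, this]

lemma isBalanced_shuffled (hh : 3 ≤ h) (hm : m ≤ 2 ^ (h + 1)) (hm4 : m % 4 = 1) :
    IsBalanced 2 h m fun y => shuffle (y / 2) := by
  intro c hc h0 h2 b hb hbc
  obtain ⟨y, hy⟩ := card_ne_zero.1 h0
  obtain ⟨hy1, hy2⟩ := mem_filter.1 hy
  have hym := mem_range.1 hy1
  have hmy : m = 2 * (y / 2) + 1 := by
    by_contra hne
    refine h2 ?_
    rw [filter_div_two_mod (by omega) hm hym hy2, card_eq_two]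
    refine ⟨y / 2 * 2, y / 2 * 2 + 1, by omega, ?_⟩
    ext u
    simp only [mem_filter, mem_range, mem_insert, mem_singleton]
    omega
  have hcy : c = shuffle (y / 2) := by
    rw [← hy2, shuffle_mod_two_pow _ (by omega), Nat.mod_eq_of_lt]
    rw [pow_succ] at hm
    omega
  have hlarge : m / 2 ≤ below 2 m (fun y => shuffle (y / 2)) 0 b → ∀ i, 2 ≤ i → i < h →
      ∀ a, (i + 1) * (∑ j ∈ range (h - i), 2 ^ j + below 2 m (fun y => shuffle (y / 2)) i a) ≤
        ∑ j ∈ range h, 2 ^ j + below 2 m (fun y => shuffle (y / 2)) 0 b := by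
    intro hb0 i hi hih a
    have hle := below_shuffled_le (m := m) (a := a) (show 1 ≤ i by omega)
    have hle' : below 2 m (fun y => shuffle (y / 2)) i a ≤ m :=
      (card_filter_le _ _).trans_eq (card_range m)
    have hQ := pow_mul_div_le (m := m) (i + 1) (show 1 ≤ 2 by omega)
    rw [sum_pow_eq 2 hih.le]
    have hi1 := sum_two_pow i
    have hG := one_le_sum_pow 2 (show 1 ≤ h - i by omega)
    have hpow : 2 ^ (i + 1) = 2 * 2 ^ i := by ring
    rw [hpow] at hQ
    rcases hi.lt_or_eq with hi3 | rfl
    · have h3 := two_mul_add_two_le_two_pow hi3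
      generalize 2 ^ i = K at *
      generalize m / 2 ^ (i + 2) = Q at *
      generalize m / 2 ^ (i + 1 + 1) = Q at *
      generalize (∑ j ∈ range (h - i), 2 ^ j) = G at *
      nlinarith
    · have hG3 : (∑ j ∈ range (h - 2), 2 ^ j) = 1 ∨ 3 ≤ ∑ j ∈ range (h - 2), 2 ^ j := by
        rcases hh.lt_or_eq with h4 | rfl
        · exact Or.inr ((Nat.add_le_add_right (show 2 ≤ h - 2 by omega) 1).trans
            (succ_le_sum_pow le_rfl (by omega)))
        · exact Or.inl rfl
      norm_num at hle hi1 ⊢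
      omega
  have hcase : m % 8 = 1 ∨ m % 8 = 5 := by omega
  obtain ⟨q, hq⟩ : ∃ q, m / 8 = q := ⟨_, rfl⟩
  rcases hcase with h8 | h8
  · obtain rfl : m = 8 * q + 1 := by omega
    have hc4 : c % 4 = 0 := by
      rw [hcy]
      simp only [shuffle]
      split_ifs <;> omega
    obtain rfl : b = 1 := by omega
    rw [show c % 2 = 0 by omega]
    have e0 := below_shuffled_zero q 1 0 (by norm_num)
    have e1 := below_shuffled_zero q 1 1 (by norm_num)
    rw [show ((range 8).filter fun y => shuffle (y / 2) % 2 = 0).card = 4 by decide,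
      show ((range 1).filter fun y => shuffle (y / 2) % 2 = 0).card = 1 by decide] at e0
    rw [show ((range 8).filter fun y => shuffle (y / 2) % 2 = 1).card = 4 by decide,
      show ((range 1).filter fun y => shuffle (y / 2) % 2 = 1).card = 0 by decide] at e1
    refine ⟨by omega, fun i hi hih a ha => ?_⟩
    rcases hi.lt_or_eq with hi2 | rfl
    · exact (hlarge (by omega) i hi2 hih a).trans (Nat.le_add_right _ _)
    · have e2 := below_shuffled_one q 1 a (by norm_num)
      rw [sum_pow_eq 2 hih.le]
      norm_num at ha ⊢
      rw [hc4]
      interval_cases a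
      · rw [show ((range 8).filter fun y => shuffle (y / 2) % 4 = 0).card = 2 by decide,
          show ((range 1).filter fun y => shuffle (y / 2) % 4 = 0).card = 1 by decide] at e2
        norm_num
        omega
      · rw [show ((range 8).filter fun y => shuffle (y / 2) % 4 = 1).card = 2 by decide,
          show ((range 1).filter fun y => shuffle (y / 2) % 4 = 1).card = 0 by decide] at e2
        norm_num
        omega
      · rw [show ((range 8).filter fun y => shuffle (y / 2) % 4 = 2).card = 2 by decide,
          show ((range 1).filter fun y => shuffle (y / 2) % 4 = 2).card = 0 by decide] at e2
        norm_num
        omega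
      · rw [show ((range 8).filter fun y => shuffle (y / 2) % 4 = 3).card = 2 by decide,
          show ((range 1).filter fun y => shuffle (y / 2) % 4 = 3).card = 0 by decide] at e2
        norm_num
        omega
  · obtain rfl : m = 8 * q + 5 := by omega
    have hc4 : c % 4 = 1 := by
      rw [hcy]
      simp only [shuffle]
      split_ifs <;> omega
    obtain rfl : b = 0 := by omega
    rw [show c % 2 = 1 by omega]
    have e0 := below_shuffled_zero q 5 0 (by norm_num)
    have e1 := below_shuffled_zero q 5 1 (by norm_num)
    rw [show ((range 8).filter fun y => shuffle (y / 2) % 2 = 0).card = 4 by decide,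
      show ((range 5).filter fun y => shuffle (y / 2) % 2 = 0).card = 4 by decide] at e0
    rw [show ((range 8).filter fun y => shuffle (y / 2) % 2 = 1).card = 4 by decide,
      show ((range 5).filter fun y => shuffle (y / 2) % 2 = 1).card = 1 by decide] at e1
    refine ⟨by omega, fun i hi hih a ha => ?_⟩
    refine le_trans ?_ (Nat.le_add_right _ _)
    rcases hi.lt_or_eq with hi2 | rfl
    · exact hlarge (by omega) i hi2 hih a
    · have hle := below_shuffled_le (m := 8 * q + 5) (a := a) (le_refl 1)
      rw [sum_pow_eq 2 hih.le]
      norm_num at hle ⊢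
      omega

end Shuffled

section Transport

variable {W : Type} [DecidableEq W]

/-- The image of a wiring under a bijection. -/
def transport (e : V ≃ W) (s : V → Finset V) (w : W) : Finset W := (s (e.symm w)).map e.toEmbedding

lemma transport_apply (e : V ≃ W) (s : V → Finset V) (v : V) :
    transport e s (e v) = (s v).map e.toEmbedding := by
  rw [transport, e.symm_apply_apply]

lemma connIn_transport (e : V ≃ W) (s : V → Finset V) (i : ℕ) (v u : V) :
    connIn (transport e s) i (e v) (e u) ↔ connIn s i v u := by
  induction i generalizing v with
  | zero => simp [connIn]
  | succ i ih => simp [connIn, -mem_map_equiv, transport_apply, ih]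

lemma distW_transport (e : V ≃ W) (s : V → Finset V) (M : ℕ) (v u : V) :
    distW (transport e s) M (e v) (e u) = distW s M v u := by
  classical
  have h := connIn_transport e s
  unfold distW
  by_cases hex : ∃ i, connIn s i v u
  · rw [dif_pos hex, dif_pos (by simpa only [h] using hex)]
    exact Nat.find_congr' fun {i} => h i v u
  · rw [dif_neg hex, dif_neg (by simpa only [h] using hex)]

variable [Fintype V] [Fintype W]

lemma cost_transport (e : V ≃ W) (s : V → Finset V) (M : ℕ) (v : V) :
    cost (transport e s) M (e v) = cost s M v := by
  rw [cost_eq_sum, cost_eq_sum, ← Equiv.sum_comp e]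
  exact sum_congr rfl fun u _ => distW_transport e s M v u

lemma transport_update (e : V ≃ W) (s : V → Finset V) (v : V) (t : Finset W) :
    Function.update (transport e s) (e v) t =
      transport e (Function.update s v (t.map e.symm.toEmbedding)) := by
  funext w
  obtain ⟨u, rfl⟩ := e.surjective w
  rw [transport_apply]
  by_cases huv : u = v
  · subst huv
    rw [Function.update_self, Function.update_self]
    ext x
    simp
  · rw [Function.update_of_ne huv, Function.update_of_ne (e.injective.ne huv), transport_apply]

lemma isWiring_stable_transport {k M : ℕ} (e : V ≃ W) {s : V → Finset V} (hs : IsWiring k s)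
    (hst : Stable k M s) : IsWiring k (transport e s) ∧ Stable k M (transport e s) := by
  constructor
  · intro w
    obtain ⟨v, rfl⟩ := e.surjective w
    rw [transport_apply, card_map]
    simpa using hs v
  · intro w t hwt ht
    obtain ⟨v, rfl⟩ := e.surjective w
    rw [transport_update, cost_transport, cost_transport]
    refine hst v _ ?_ (by rwa [card_map])
    simpa using hwt

end Transport

namespace Node

variable {k h m M : ℕ}

lemma stable_wiring {φ : ℕ → ℕ} (hk : 1 ≤ k) (hh : 1 ≤ h) (h2 : 2 ≤ h ∨ k = 1 ∧ 1 ≤ m)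
    (hfib : ∀ x, ((range m).filter fun y => φ y % k ^ h = x).card ≤ k)
    (hφ : 2 ≤ k → IsBalanced k h m φ)
    (hleaf : ∀ c < k ^ h, ((range m).filter fun y => φ y % k ^ h = c).card = 0 →
      (3 ≤ k ∧ ∀ x, ((range m).filter fun y => φ y % k ^ h = x).card ≤ 1) ∨ (k = 2 ∧ 3 ≤ h))
    (hm : 1 ≤ m) (hM : Fintype.card (Node k h m) ^ 2 < M) :
    ∃ s : Node k h m → Finset (Node k h m), IsWiring k s ∧ Stable k M s := by
  obtain ⟨F, hF⟩ : ∃ F, F = forest m φ hk hh h2 hfib := ⟨_, rfl⟩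
  obtain ⟨Y, hY⟩ := F.exists_isFilling
  have hcard : h + 1 ≤ Fintype.card (Node k h m) := by
    rw [card_eq]
    refine Nat.add_le_add ?_ hm
    calc h = ∑ i ∈ range h, 1 := by simp
      _ ≤ _ := sum_le_sum fun i _ => Nat.pow_pos hk
  have hlev : ∀ v : Node k h m, F.lev v = v.idx + 1 := by
    rw [hF]
    exact fun _ => rfl
  have hch : ∀ v : Node k h m, F.lev v = h →
      (F.ch v).card = ((range m).filter fun y => φ y % k ^ h = v.pos).card := by
    intro v hv
    rw [hlev] at hv
    rw [hF]
    exact card_children_of_eq hk hv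
  refine ⟨F.wiring Y, F.stable_wiring hY hM (by nlinarith) (fun v hv hc => ?_)
    (stable_condition hk hh h2 hfib hφ hF)⟩
  have hp := v.pos_lt
  have hv' := hlev v
  rw [if_pos (by omega), show v.idx + 1 = h by omega] at hp
  rw [← card_eq_zero, hch v hv] at hc
  refine (hleaf _ hp hc).imp (fun h3 => ⟨h3.1, fun u hu => ?_⟩) id
  rw [hch u hu]
  exact h3.2 _

lemma exists_stable (hm : 1 ≤ m) (hmk : m ≤ k ^ (h + 1))
    (hkh : (k = 1 ∧ m = 1 ∧ 1 ≤ h) ∨ (3 ≤ k ∧ 2 ≤ h) ∨ (k = 2 ∧ 3 ≤ h) ∨ (k = 2 ∧ h = 2 ∧ 4 ≤ m ∧ m ≠ 5))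
    (hM : Fintype.card (Node k h m) ^ 2 < M) :
    ∃ s : Node k h m → Finset (Node k h m), IsWiring k s ∧ Stable k M s := by
  have hk : 1 ≤ k := by omega
  by_cases hc : k = 2 ∧ m % 4 = 1
  · obtain ⟨rfl, hm4⟩ := hc
    have h3 : 3 ≤ h := by
      by_contra h3
      obtain rfl : h = 2 := by omega
      omega
    exact stable_wiring hk (by omega) (by omega) (card_fiber_shuffled (by omega) hmk)
      (fun _ => isBalanced_shuffled (by omega) hmk hm4) (fun _ _ _ => Or.inr (by omega)) hm hM
  · refine stable_wiring hk (by omega) (by omega) (card_fiber_cyclic hmk hk)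
      (fun _ => isBalanced_cyclic (by omega) (by omega)) (fun c hck h0 => ?_) hm hM
    simp only [Nat.mod_mod] at h0 ⊢
    rw [card_filter_mod m hck] at h0
    have hmc : m ≤ c := by
      obtain ⟨h1, h2⟩ := Nat.add_eq_zero_iff.1 h0
      rw [Nat.div_eq_zero_iff_lt (by omega)] at h1
      rw [Nat.mod_eq_of_lt h1] at h2
      by_contra h3
      rw [if_pos (by omega)] at h2
      omega
    rcases hkh with ⟨rfl, rfl, -⟩ | ⟨hk3, -⟩ | h3 | ⟨rfl, rfl, h4, -⟩
    · rw [one_pow] at hck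
      omega
    · refine Or.inl ⟨hk3, fun x => ?_⟩
      refine (card_le_card (t := {x}) fun y hy => ?_).trans_eq (card_singleton x)
      obtain ⟨h1, h2⟩ := mem_filter.1 hy
      rw [Nat.mod_eq_of_lt ((mem_range.1 h1).trans_le (hmc.trans hck.le))] at h2
      exact mem_singleton.2 h2
    · exact Or.inr h3
    · omega

end Node

lemma exists_stable_of_large {n k M : ℕ} (hM : n ^ 2 < M)
    (hkn : (k = 1 ∧ 2 ≤ n) ∨ (3 ≤ k ∧ k ^ 2 + k < n) ∨ (k = 2 ∧ 9 < n ∧ n ≠ 11)) :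
    ∃ s : Fin n → Finset (Fin n), IsWiring k s ∧ Stable k M s := by
  have hk : 1 ≤ k := by omega
  have hex : ∃ h, n ≤ ∑ i ∈ range h, k ^ (i + 1) := by
    refine ⟨n, ?_⟩
    calc n = ∑ i ∈ range n, 1 := by simp
      _ ≤ _ := sum_le_sum fun i _ => Nat.pow_pos hk
  obtain ⟨h, hh⟩ : ∃ h, Nat.find hex = h + 1 := by
    refine Nat.exists_eq_succ_of_ne_zero fun h0 => ?_
    have := Nat.find_spec hex
    rw [h0, sum_range_zero] at this
    omega
  have h1 := Nat.find_spec hex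
  have h2 := Nat.find_min hex (show h < _ by omega)
  rw [hh, sum_range_succ] at h1
  obtain ⟨m, hm⟩ := Nat.exists_eq_add_of_lt (not_le.1 h2)
  have hcard : Fintype.card (Node k h (m + 1)) = n := by
    rw [Node.card_eq, hm, add_assoc]
  obtain ⟨s, hs, hst⟩ := Node.exists_stable (k := k) (h := h) (m := m + 1) (M := M) (by omega)
    (by omega) (by
      rcases hkn with ⟨rfl, hn⟩ | ⟨hk3, hn⟩ | ⟨rfl, hn⟩
      · simp only [one_pow, sum_const, card_range, smul_eq_mul, mul_one] at h1 hm
        omega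
      · refine Or.inr (Or.inl ⟨hk3, ?_⟩)
        by_contra h3
        obtain rfl | rfl : h = 0 ∨ h = 1 := by omega
        · simp at h1
          nlinarith
        · simp at h1
          omega
      · refine Or.inr (Or.inr ?_)
        by_cases h3 : 3 ≤ h
        · exact Or.inl ⟨rfl, h3⟩
        · obtain rfl | rfl | rfl : h = 0 ∨ h = 1 ∨ h = 2 := by omega
          all_goals
            simp [sum_range_succ] at h1 hm
            omega)
    (by rwa [hcard])
  exact ⟨_, isWiring_stable_transport (Fintype.equivFinOfCardEq hcard) hs hst⟩

section Classes

variable [Fintype V] {C : Type} [Fintype C] [DecidableEq C] {k M : ℕ}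

lemma exists_stable_of_classes (hC : Fintype.card C = k + 1) (hV : k + 1 ≤ Fintype.card V)
    (hM : 2 ≤ M) (cls f : V → C) (w : C → V) (hw : ∀ c, f (w c) = c) (hf : ∀ v, f v ≠ cls v)
    (hinj : ∀ u v, cls u = cls v → f u = f v → u = v) :
    ∃ s : V → Finset V, IsWiring k s ∧ Stable k M s := by
  have hext : ∀ v, ∃ t : Finset V, v ∉ t ∧ t.card = k ∧ (∀ u, cls u = f v → u ∈ t) ∧
      ∀ c, c = f v ∨ (∃ u, cls u = f v ∧ f u = c) ∨ w c ∈ t := by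
    intro v
    set A := univ.filter fun u => cls u = f v with hA
    set B := (univ.erase (f v)) \ A.image f with hB
    have hsub : A ∪ B.image w ⊆ univ.erase v := by
      intro u hu
      rw [mem_erase]
      refine ⟨?_, mem_univ _⟩
      rintro rfl
      rcases mem_union.1 hu with h1 | h1
      · exact hf _ (mem_filter.1 h1).2.symm
      · obtain ⟨c, hc, rfl⟩ := mem_image.1 h1
        rw [hB, mem_sdiff, mem_erase, hw] at hc
        exact hc.1.1 rfl
    have hcard : (A ∪ B.image w).card ≤ k := by
      have h1 : (A.image f).card = A.card := card_image_of_injOn fun u hu v hv huv =>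
        hinj u v ((mem_filter.1 hu).2.trans (mem_filter.1 hv).2.symm) huv
      have h2 : A.image f ⊆ univ.erase (f v) := by
        intro c hc
        obtain ⟨u, hu, rfl⟩ := mem_image.1 hc
        rw [mem_erase]
        exact ⟨fun h3 => hf u (h3.trans (mem_filter.1 hu).2.symm), mem_univ _⟩
      have h3 := card_sdiff_add_card_eq_card h2
      rw [card_erase_of_mem (mem_univ _), card_univ, hC, h1, ← hB] at h3
      have h4 := card_union_le A (B.image w)
      have h5 : (B.image w).card ≤ B.card := card_image_le
      omega
    obtain ⟨t, ht1, ht2, ht3⟩ := exists_subsuperset_card_eq hsub hcard (by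
      rw [card_erase_of_mem (mem_univ _), card_univ]
      omega)
    refine ⟨t, fun hv => (mem_erase.1 (ht2 hv)).1 rfl, ht3,
      fun u hu => ht1 (mem_union_left _ (mem_filter.2 ⟨mem_univ _, hu⟩)), fun c => ?_⟩
    by_cases hc : c = f v
    · exact Or.inl hc
    by_cases hcA : c ∈ A.image f
    · obtain ⟨u, hu, huc⟩ := mem_image.1 hcA
      exact Or.inr (Or.inl ⟨u, (mem_filter.1 hu).2, huc⟩)
    · exact Or.inr (Or.inr (ht1 (mem_union_right _ (mem_image_of_mem w
        (mem_sdiff.2 ⟨mem_erase.2 ⟨hc, mem_univ _⟩, hcA⟩)))))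
  choose s hvs hcard hcls hcov using hext
  refine ⟨s, fun v => ⟨hvs v, (hcard v).le⟩, fun v => ?_⟩
  have h1 : ∀ v u, u ∈ s v → u ∈ ball s 1 v := fun v u hu =>
    ball_step (self_mem_ball s 0 v) hu
  refine stableAt_of_moore_le (D := 2) (fun v => (hcard v).le) hM (fun i hi => ?_) ?_
  · obtain rfl | rfl : i = 0 ∨ i = 1 := by omega
    · exact card_pos.2 ⟨v, self_mem_ball s 0 v⟩
    · calc moore k 1 = (insert v (s v)).card := by
            rw [card_insert_of_notMem (hvs v), hcard]
            simp [moore, add_comm]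
        _ ≤ _ := card_le_card (insert_subset (self_mem_ball s 1 v) (h1 v))
  · rw [eq_univ_iff_forall]
    intro u
    rcases hcov v (cls u) with h2 | ⟨x, hx, hxu⟩ | h2
    · exact ball_mem_of_le (h1 v u (hcls v u h2)) one_le_two
    · exact ball_step (h1 v x (hcls v x hx)) (hcls x u hxu.symm)
    · exact ball_step (h1 v _ h2) (hcls _ u (hw _).symm)

end Classes

lemma exists_stable_of_small {n k M : ℕ} (hM : n ^ 2 < M) (hkn : k < n) (hk : 1 ≤ k)
    (hn : n ≤ k ^ 2 + k) : ∃ s : Fin n → Finset (Fin n), IsWiring k s ∧ Stable k M s := by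
  have hq : ∀ i : Fin n, (i : ℕ) / (k + 1) < k := fun i => by
    rw [Nat.div_lt_iff_lt_mul (by omega)]
    nlinarith [i.2]
  refine exists_stable_of_classes (C := ZMod (k + 1)) (ZMod.card _) (by simpa using hkn)
    (by nlinarith) (fun i => ((i : ℕ) : ZMod (k + 1)))
    (fun i => ((i + 1 + i / (k + 1) : ℕ) : ZMod (k + 1)))
    (fun c => ⟨(c - 1).val, (ZMod.val_lt _).trans_le hkn⟩) (fun c => ?_) (fun i => ?_) ?_
  · dsimp only
    rw [Nat.div_eq_of_lt (ZMod.val_lt _)]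
    simp
  · intro h
    have h1 : ((1 + i / (k + 1) : ℕ) : ZMod (k + 1)) = 0 := by
      push_cast at h ⊢
      linear_combination h
    rw [ZMod.natCast_eq_zero_iff] at h1
    have := Nat.le_of_dvd (Nat.add_pos_left one_pos _) h1
    have := hq i
    omega
  · intro i j h1 h2
    have h3 : ((i / (k + 1) : ℕ) : ZMod (k + 1)) = ((j / (k + 1) : ℕ) : ZMod (k + 1)) := by
      push_cast at h1 h2 ⊢
      linear_combination h2 - h1
    rw [ZMod.natCast_eq_natCast_iff'] at h1 h3
    have hi := hq i
    have hj := hq j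
    rw [Nat.mod_eq_of_lt (by omega), Nat.mod_eq_of_lt (by omega)] at h3
    rw [Fin.ext_iff, ← Nat.div_add_mod i (k + 1), ← Nat.div_add_mod j (k + 1), h1, h3]

lemma stableAt_of_two_step [Fintype V] {s : V → Finset V} {k M : ℕ} {v : V} (hM : 3 ≤ M)
    (hv : v ∉ s v) (hs : (s v).card = k) (h3 : ball s 3 v = univ)
    (h2 : ∀ t : Finset V, v ∉ t → t.card ≤ k →
      (insert v (t ∪ t.biUnion s)).card ≤ (ball s 2 v).card) : StableAt k M s v := by
  intro t hvt ht
  have hb1 : ∀ s' : V → Finset V, ball s' 1 v = insert v (s' v) := fun s' => by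
    rw [ball_succ_eq_insert]
    simp [ball]
  refine (cost_le_sum_compl h3).trans (le_trans (sum_le_sum fun i hi => ?_) (sum_compl_le_cost hM))
  have hi3 := mem_range.1 hi
  have key : (ball (Function.update s v t) i v).card ≤ (ball s i v).card := by
    obtain rfl | rfl | rfl : i = 0 ∨ i = 1 ∨ i = 2 := by omega
    · rfl
    · rw [hb1, hb1, Function.update_self, card_insert_of_notMem hv, hs]
      exact (card_insert_le _ _).trans (Nat.succ_le_succ ht)
    · refine (card_le_card fun u hu => ?_).trans (h2 t hvt ht)
      rw [mem_ball_succ, hb1, Function.update_self] at hu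
      rw [mem_insert, mem_union, mem_biUnion]
      rcases hu with hu | ⟨w, hw, hu⟩
      · exact (mem_insert.1 hu).imp id Or.inl
      · rcases mem_insert.1 hw with rfl | hw
        · rw [Function.update_self] at hu
          exact Or.inr (Or.inl hu)
        · rw [Function.update_of_ne (fun h : w = v => hvt (h ▸ hw))] at hu
          exact Or.inr (Or.inr ⟨w, hw, hu⟩)
  rw [card_compl, card_compl]
  exact Nat.sub_le_sub_left key _

/-- A finite check that the wiring linking every `v` to `f v` and `g v` is stable. -/
def IsOptimalPair {n : ℕ} (f g : Fin n → Fin n) : Prop :=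
  ∀ v, v ∉ ({f v, g v} : Finset (Fin n)) ∧ f v ≠ g v ∧
    ball (fun u => {f u, g u}) 3 v = univ ∧
    ∀ a b, (insert v ({a, b, f a, g a, f b, g b} : Finset (Fin n))).card ≤
      (ball (fun u => {f u, g u}) 2 v).card

instance {n : ℕ} (f g : Fin n → Fin n) : Decidable (IsOptimalPair f g) := by
  unfold IsOptimalPair
  infer_instance

lemma exists_stable_of_isOptimalPair {n M : ℕ} (hn : 2 ≤ n) (hM : n ^ 2 < M) {f g : Fin n → Fin n}
    (h : IsOptimalPair f g) : ∃ s : Fin n → Finset (Fin n), IsWiring 2 s ∧ Stable 2 M s := by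
  refine ⟨fun u => {f u, g u}, fun v => ⟨(h v).1, card_le_two⟩, fun v => ?_⟩
  obtain ⟨hv, hfg, h3, h2⟩ := h v
  refine stableAt_of_two_step (by nlinarith) hv (card_pair hfg) h3 fun t _ ht => ?_
  obtain ⟨t', htt, ht'⟩ := exists_superset_card_eq ht (by simpa using hn)
  obtain ⟨a, b, -, rfl⟩ := card_eq_two.1 ht'
  refine (card_le_card fun u hu => ?_).trans (h2 a b)
  simp only [mem_insert, mem_union, mem_biUnion, mem_singleton] at hu ⊢
  rcases hu with rfl | hu | ⟨w, hw, hu⟩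
  · exact Or.inl rfl
  · have := htt hu
    simp only [mem_insert, mem_singleton] at this
    tauto
  · have := htt hw
    simp only [mem_insert, mem_singleton] at this
    rcases this with rfl | rfl <;> tauto

lemma exists_stable_of_exceptional {n M : ℕ} (hM : n ^ 2 < M)
    (hn : n = 7 ∨ n = 8 ∨ n = 9 ∨ n = 11) :
    ∃ s : Fin n → Finset (Fin n), IsWiring 2 s ∧ Stable 2 M s := by
  rcases hn with rfl | rfl | rfl | rfl
  · exact exists_stable_of_isOptimalPair (by norm_num) hM (f := ![3, 3, 1, 4, 2, 0, 0])
      (g := ![4, 6, 5, 5, 6, 1, 2]) (by decide +kernel)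
  · exact exists_stable_of_isOptimalPair (by norm_num) hM (f := ![1, 2, 0, 4, 0, 2, 3, 1])
      (g := ![6, 4, 3, 7, 5, 7, 5, 6]) (by decide +kernel)
  · exact exists_stable_of_isOptimalPair (by norm_num) hM (f := ![4, 0, 0, 4, 2, 1, 1, 3, 2])
      (g := ![6, 7, 7, 6, 5, 3, 8, 8, 5]) (by decide +kernel)
  · exact exists_stable_of_isOptimalPair (by norm_num) hM
      (f := ![3, 6, 1, 1, 0, 7, 8, 2, 2, 3, 0]) (g := ![5, 10, 5, 8, 6, 9, 9, 4, 4, 10, 7])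
      (by decide +kernel)

end

/-- For every `n ≥ 2` and `1 ≤ k < n`, the uniform `(n,k)`-BDNF game has a
stable wiring. -/
theorem stmt_0 :
    ∀ n : ℕ, 2 ≤ n → ∀ k : ℕ, 1 ≤ k → k < n → ∀ M : ℕ, n ^ 2 < M →
      ∃ s : Fin n → Finset (Fin n), IsWiring k s ∧ Stable k M s := by
  intro n hn k hk hkn M hM
  by_cases hsmall : n ≤ k ^ 2 + k ∧ 2 ≤ k
  · exact exists_stable_of_small hM hkn hk hsmall.1
  · by_cases hex : k = 2 ∧ (n = 7 ∨ n = 8 ∨ n = 9 ∨ n = 11)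
    · obtain ⟨rfl, h⟩ := hex
      exact exists_stable_of_exceptional hM h
    · refine exists_stable_of_large hM ?_
      rcases lt_trichotomy k 2 with h | rfl | h
      · exact Or.inl ⟨by omega, hn⟩
      · refine Or.inr (Or.inr ⟨rfl, ?_⟩)
        norm_num at hsmall
        omega
      · exact Or.inr (Or.inl ⟨h, by by_contra hc; exact hsmall ⟨by omega, by omega⟩⟩)

end BDNF
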